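/- arXiv:1706.08311 — 6 statements merged into one kernel-verified Lean document; each statement's English description precedes it below -/
import Mathlib

section
/- Let N ≥ 2, α ∈ [0,1), and β̃ ∈ ℝ. Let Φ be a radially symmetric solution (twice continuously differentiable in x, once in t) of the equation ∂_tΦ = |x|^α ΔΦ on (ℝ^N ∖ {0}) × (0,∞). Then Φ satisfies the self-similarity relation Φ(x,t) = λ^{−β̃} Φ(λx, λ^{2−α} t) for every λ > 0, every x ∈ ℝ^N ∖ {0} and t > 0, if and only if Φ(x,t) = t^{β̃/(2−α)} φ(|x|^{2−α}/((2−α)² t)) for some φ ∈ C^∞((0,∞)) satisfying s φ''(s) + ((N−α)/(2−α) + s) φ'(s) − (β̃/(2−α)) φ(s) = 0 for all s > 0. -/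
open Real MeasureTheory Filter Set

noncomputable section

/-- Euclidean space `ℝ^N`. -/
abbrev E (N : ℕ) := EuclideanSpace ℝ (Fin N)

/-- Kummer's confluent hypergeometric function of the first kind
`M(b,c;s) = Σ_{n=0}^∞ ((b)_n/(c)_n) s^n/n!`. -/
def kummerM (b c s : ℝ) : ℝ :=
  ∑' n : ℕ,
    ((∏ k ∈ Finset.range n, (b + (k : ℝ))) / (∏ k ∈ Finset.range n, (c + (k : ℝ))))
      * s ^ n / (n.factorial : ℝ)

/-- `φ_β(s) = e^{−s} M((N−α)/(2−α) − β, (N−α)/(2−α); s)`. -/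
def phiK (N : ℕ) (α β s : ℝ) : ℝ :=
  Real.exp (-s) * kummerM (((N : ℝ) - α) / (2 - α) - β) (((N : ℝ) - α) / (2 - α)) s

/-- `Φ_β(x,t) = t^{−β} φ_β(|x|^{2−α}/((2−α)² t))`. -/
def PhiK (N : ℕ) (α β : ℝ) (x : E N) (t : ℝ) : ℝ :=
  t ^ (-β) * phiK N α β (‖x‖ ^ (2 - α) / ((2 - α) ^ 2 * t))

/-- The Laplacian of a real-valued function on `ℝ^N`. -/
def laplacian {N : ℕ} (f : E N → ℝ) (x : E N) : ℝ :=
  ∑ i : Fin N,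
    fderiv ℝ (fun y => fderiv ℝ f y (EuclideanSpace.single i 1)) x (EuclideanSpace.single i 1)

/-- The weight `Ψ^β(x,t) = (t + |x|^{2−α}/(2−α)²)^β`. -/
def Psi {N : ℕ} (α β : ℝ) (x : E N) (t : ℝ) : ℝ :=
  (t + ‖x‖ ^ (2 - α) / (2 - α) ^ 2) ^ β

lemma ssc_lap {N : ℕ} (f : E N → ℝ) (h : ℝ → ℝ) (hf : ∀ y : E N, y ≠ 0 → f y = h (‖y‖ ^ 2))
    (hh : ContDiffOn ℝ 2 h (Ioi 0)) (x : E N) (hx : x ≠ 0) :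
    laplacian f x = 4 * ‖x‖ ^ 2 * deriv (deriv h) (‖x‖ ^ 2) + 2 * N * deriv h (‖x‖ ^ 2) := by
  have pos : ∀ y : E N, y ≠ 0 → (0 : ℝ) < ‖y‖ ^ 2 := fun y hy => by positivity
  have hd1 : ∀ q : ℝ, 0 < q → HasDerivAt h (deriv h q) q := fun q hq =>
    ((hh.differentiableOn (by norm_num)).differentiableAt (Ioi_mem_nhds hq)).hasDerivAt
  have hd2 : ∀ q : ℝ, 0 < q → HasDerivAt (deriv h) (deriv (deriv h) q) q := fun q hq => by
    have h2 : ContDiffOn ℝ (1 + 1) h (Ioi 0) := by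
      have : (1 + 1 : WithTop ℕ∞) = 2 := by norm_num
      rw [this]; exact hh
    have := ((contDiffOn_succ_iff_deriv_of_isOpen isOpen_Ioi).1 h2).2.2
    exact ((this.differentiableOn (by norm_num)).differentiableAt (Ioi_mem_nhds hq)).hasDerivAt
  have hsq : ∀ y : E N, HasFDerivAt (fun z : E N => ‖z‖ ^ 2) (2 • (innerSL ℝ y)) y := fun y =>
    (hasStrictFDerivAt_norm_sq y).hasFDerivAt
  have hne : ∀ y : E N, y ≠ 0 → ∀ᶠ z in nhds y, z ≠ 0 := fun y hy =>
    isOpen_ne.mem_nhds hy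
  have hF1 : ∀ y : E N, y ≠ 0 → ∀ i, fderiv ℝ f y (EuclideanSpace.single i 1)
      = deriv h (‖y‖ ^ 2) * (2 * y i) := by
    intro y hy i
    have h1 := (hd1 _ (pos y hy)).comp_hasFDerivAt y (hsq y)
    have h2 : HasFDerivAt f _ y := h1.congr_of_eventuallyEq ((hne y hy).mono hf)
    rw [h2.fderiv]
    simp [EuclideanSpace.inner_single_right]
  have hF2 : ∀ i, fderiv ℝ (fun y => fderiv ℝ f y (EuclideanSpace.single i 1)) x
      (EuclideanSpace.single i 1) =
      4 * deriv (deriv h) (‖x‖ ^ 2) * (x i) ^ 2 + 2 * deriv h (‖x‖ ^ 2) := by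
    intro i
    have h1 := (hd2 _ (pos x hx)).comp_hasFDerivAt x (hsq x)
    have h3 : HasFDerivAt (fun y : E N => 2 * y i)
        ((2 : ℝ) • (EuclideanSpace.proj i : E N →L[ℝ] ℝ)) x :=
      ((EuclideanSpace.proj i : E N →L[ℝ] ℝ).hasFDerivAt).const_mul 2
    have h2 : HasFDerivAt (fun y => fderiv ℝ f y (EuclideanSpace.single i 1)) _ x :=
      (h1.mul h3).congr_of_eventuallyEq ((hne x hx).mono fun y hy => hF1 y hy i)
    rw [h2.fderiv]
    simp [EuclideanSpace.inner_single_right]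
    ring
  unfold laplacian
  rw [Finset.sum_congr rfl fun i _ => hF2 i, Finset.sum_add_distrib, ← Finset.mul_sum,
    ← EuclideanSpace.real_norm_sq_eq]
  simp
  ring

lemma ssc_boot (φ : ℝ → ℝ) (a b : ℝ) (h2 : ContDiffOn ℝ 2 φ (Ioi 0))
    (ode : ∀ s : ℝ, 0 < s → s * deriv (deriv φ) s + (a + s) * deriv φ s - b * φ s = 0) :
    ContDiffOn ℝ (⊤ : ℕ∞) φ (Ioi 0) := by
  have h11 : ContDiffOn ℝ (1 + 1) φ (Ioi 0) := by
    have : (1 + 1 : WithTop ℕ∞) = 2 := by norm_num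
    rw [this]; exact h2
  have hD := ((contDiffOn_succ_iff_deriv_of_isOpen isOpen_Ioi).1 h11).2.2.differentiableOn
    (by norm_num)
  have hD0 := h2.differentiableOn (by norm_num)
  have key : ∀ n : ℕ, ContDiffOn ℝ ((n : WithTop ℕ∞) + 1) φ (Ioi 0) := by
    intro n
    induction n with
    | zero => exact h2.of_le (by norm_num)
    | succ n ih =>
      have hd := ((contDiffOn_succ_iff_deriv_of_isOpen isOpen_Ioi).1 ih).2.2
      have hn : ContDiffOn ℝ (n : WithTop ℕ∞) φ (Ioi 0) := ih.of_le (by simp)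
      have hdd : ContDiffOn ℝ (n : WithTop ℕ∞) (deriv (deriv φ)) (Ioi 0) := by
        have : ContDiffOn ℝ (n : WithTop ℕ∞)
            (fun s => (b * φ s - (a + s) * deriv φ s) / s) (Ioi 0) := by
          refine ContDiffOn.div ?_ contDiffOn_id fun s hs => ne_of_gt hs
          exact (contDiffOn_const.mul hn).sub ((contDiffOn_const.add contDiffOn_id).mul hd)
        refine this.congr fun s hs => ?_
        have hs' : (0 : ℝ) < s := hs
        rw [eq_div_iff hs'.ne']
        linarith [ode s hs]
      push_cast
      refine (contDiffOn_succ_iff_deriv_of_isOpen isOpen_Ioi).2 ⟨hD0, by simp, ?_⟩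
      exact (contDiffOn_succ_iff_deriv_of_isOpen isOpen_Ioi).2 ⟨hD, by simp, hdd⟩
  rw [contDiffOn_infty]
  exact fun n => (key n).of_le (by simp)

lemma ssc_chain (φ h : ℝ → ℝ) (c m : ℝ) (hc : 0 < c) (h2 : ContDiffOn ℝ 2 φ (Ioi 0))
    (hh : ∀ q, 0 < q → h q = φ (c * q ^ m)) (q : ℝ) (hq : 0 < q) :
    q * deriv h q = deriv φ (c * q ^ m) * (m * (c * q ^ m)) ∧
    q ^ 2 * deriv (deriv h) q = deriv (deriv φ) (c * q ^ m) * (m * (c * q ^ m)) ^ 2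
      + deriv φ (c * q ^ m) * (m * (m - 1) * (c * q ^ m)) := by
  have hd1 : ∀ q : ℝ, 0 < q → HasDerivAt φ (deriv φ q) q := fun q hq =>
    ((h2.differentiableOn (by norm_num)).differentiableAt (Ioi_mem_nhds hq)).hasDerivAt
  have hd2 : ∀ q : ℝ, 0 < q → HasDerivAt (deriv φ) (deriv (deriv φ) q) q := fun q hq => by
    have h2 : ContDiffOn ℝ (1 + 1) φ (Ioi 0) := by
      have : (1 + 1 : WithTop ℕ∞) = 2 := by norm_num
      rw [this]; exact h2
    have := ((contDiffOn_succ_iff_deriv_of_isOpen isOpen_Ioi).1 h2).2.2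
    exact ((this.differentiableOn (by norm_num)).differentiableAt (Ioi_mem_nhds hq)).hasDerivAt
  have hp : ∀ q : ℝ, 0 < q → 0 < c * q ^ m := fun q hq => by positivity
  have hpow : ∀ q : ℝ, 0 < q → HasDerivAt (fun q : ℝ => c * q ^ m) (c * (m * q ^ (m - 1))) q :=
    fun q hq => (Real.hasDerivAt_rpow_const (Or.inl hq.ne')).const_mul c
  have e1 : ∀ q : ℝ, 0 < q → deriv h q = deriv φ (c * q ^ m) * (c * (m * q ^ (m - 1))) := by
    intro q hq
    have := (hd1 _ (hp q hq)).comp q (hpow q hq)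
    exact (this.congr_of_eventuallyEq
      ((eventually_gt_nhds hq).mono hh)).deriv
  have e2 : deriv (deriv h) q = _ :=
    ((((hd2 _ (hp q hq)).comp q (hpow q hq)).mul
      (((Real.hasDerivAt_rpow_const (p := m - 1) (Or.inl hq.ne')).const_mul m).const_mul
        c)).congr_of_eventuallyEq
      ((eventually_gt_nhds hq).mono e1)).deriv
  have p1 : q ^ (m - 1) = q ^ m / q := by rw [Real.rpow_sub hq, Real.rpow_one]
  have p2 : q ^ (m - 1 - 1) = q ^ m / q / q := by
    rw [Real.rpow_sub hq, Real.rpow_sub hq, Real.rpow_one]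
  constructor
  · rw [e1 q hq, p1]; field_simp
  · rw [e2, p1, p2]; simp only [Function.comp]; field_simp

/-- Lemma 2.1. A radially symmetric solution of `∂_tΦ = |x|^α ΔΦ` on
`(ℝ^N ∖ {0}) × (0,∞)` is self-similar with exponent `β̃` iff it has the form
`t^{β̃/(2−α)} φ(|x|^{2−α}/((2−α)²t))` with `φ` smooth solving the associated ODE. -/
theorem self_similar_characterization
    (N : ℕ) (hN : 2 ≤ N) (α : ℝ) (hα0 : 0 ≤ α) (hα1 : α < 1) (βt : ℝ)
    (Φ : E N → ℝ → ℝ)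
    (hrad : ∀ (x y : E N) (t : ℝ), ‖x‖ = ‖y‖ → Φ x t = Φ y t)
    (hregx : ∀ t : ℝ, 0 < t → ContDiffOn ℝ 2 (fun x => Φ x t) {x : E N | x ≠ 0})
    (hregt : ∀ x : E N, x ≠ 0 → ContDiffOn ℝ 1 (Φ x) (Ioi 0))
    (hheat : ∀ (x : E N), x ≠ 0 → ∀ t : ℝ, 0 < t →
      deriv (Φ x) t = ‖x‖ ^ α * laplacian (fun y => Φ y t) x) :
    (∀ lam : ℝ, 0 < lam → ∀ (x : E N), x ≠ 0 → ∀ t : ℝ, 0 < t →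
        Φ x t = lam ^ (-βt) * Φ (lam • x) (lam ^ (2 - α) * t))
      ↔
    (∃ φ : ℝ → ℝ, ContDiffOn ℝ (⊤ : ℕ∞) φ (Ioi 0) ∧
      (∀ s : ℝ, 0 < s →
        s * deriv (deriv φ) s + (((N : ℝ) - α) / (2 - α) + s) * deriv φ s
          - (βt / (2 - α)) * φ s = 0) ∧
      (∀ (x : E N), x ≠ 0 → ∀ t : ℝ, 0 < t →
        Φ x t = t ^ (βt / (2 - α)) * φ (‖x‖ ^ (2 - α) / ((2 - α) ^ 2 * t)))) := by
  have hk : 0 < 2 - α := by linarith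
  obtain ⟨k, hkdef⟩ : ∃ k, k = 2 - α := ⟨_, rfl⟩
  rw [← hkdef] at hk
  simp only [← hkdef]
  constructor
  · intro hss
    obtain ⟨e, he⟩ : ∃ e : E N, ‖e‖ = 1 :=
      ⟨EuclideanSpace.single ⟨0, by omega⟩ 1, by simp⟩
    have he0 : e ≠ 0 := by rintro rfl; simp at he
    set φ : ℝ → ℝ := fun s => Φ (((k ^ 2 * s) ^ (1 / k)) • e) 1 with hφ
    have hrep : ∀ x : E N, x ≠ 0 → ∀ t : ℝ, 0 < t →
        Φ x t = t ^ (βt / k) * φ (‖x‖ ^ k / (k ^ 2 * t)) := by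
      intro x hx t ht
      have hxn : 0 < ‖x‖ := norm_pos_iff.2 hx
      rw [hss (t ^ (-1 / k)) (by positivity) x hx t ht]
      have a1 : (t ^ (-1 / k)) ^ (-βt) = t ^ (βt / k) := by
        rw [← Real.rpow_mul ht.le]; congr 1; ring
      have a2 : (t ^ (-1 / k)) ^ k * t = 1 := by
        rw [← Real.rpow_mul ht.le, div_mul_cancel₀ _ hk.ne', Real.rpow_neg_one,
          inv_mul_cancel₀ ht.ne']
      rw [a1, a2]
      congr 1
      apply hrad
      have a3 : k ^ 2 * (‖x‖ ^ k / (k ^ 2 * t)) = ‖x‖ ^ k / t := by field_simp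
      rw [norm_smul, norm_smul, he, a3, mul_one, Real.norm_of_nonneg (by positivity),
        Real.norm_of_nonneg (by positivity), Real.div_rpow (by positivity) ht.le,
        ← Real.rpow_mul hxn.le, mul_one_div_cancel hk.ne', Real.rpow_one, neg_div,
        Real.rpow_neg ht.le]
      field_simp
    have hφ2 : ContDiffOn ℝ 2 φ (Ioi 0) := by
      refine ContDiffOn.comp (g := fun x => Φ x 1) (t := {x : E N | x ≠ 0})
        (f := fun s : ℝ => ((k ^ 2 * s) ^ (1 / k)) • e) (hregx 1 one_pos) ?_ ?_
      · refine ContDiffOn.smul (f := fun s : ℝ => (k ^ 2 * s) ^ (1 / k)) (g := fun _ => e) ?_ contDiffOn_const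
        refine ContDiffOn.rpow_const_of_ne (contDiffOn_const.mul contDiffOn_id) ?_
        intro s hs
        have : (0 : ℝ) < s := hs
        positivity
      · intro s hs
        have : (0 : ℝ) < s := hs
        exact smul_ne_zero (by positivity) he0
    have hode : ∀ s : ℝ, 0 < s →
        s * deriv (deriv φ) s + (((N : ℝ) - α) / k + s) * deriv φ s
          - (βt / k) * φ s = 0 := by
      intro s hs
      set r : ℝ := (k ^ 2 * s) ^ (1 / k) with hr
      have hr0 : 0 < r := by positivity
      have hrk : r ^ k = k ^ 2 * s := by
        rw [hr, ← Real.rpow_mul (by positivity), one_div_mul_cancel hk.ne', Real.rpow_one]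
      have hx0 : r • e ≠ 0 := smul_ne_zero hr0.ne' he0
      have hxn : ‖r • e‖ = r := by
        rw [norm_smul, he, mul_one, Real.norm_of_nonneg hr0.le]
      have H := hheat (r • e) hx0 1 one_pos
      -- time derivative
      have hd1 : HasDerivAt φ (deriv φ s) s :=
        ((hφ2.differentiableOn (by norm_num)).differentiableAt (Ioi_mem_nhds hs)).hasDerivAt
      have hT : deriv (Φ (r • e)) 1 = βt / k * φ s - s * deriv φ s := by
        have q1 : HasDerivAt (fun t : ℝ => t ^ (βt / k)) (βt / k * 1 ^ (βt / k - 1)) 1 :=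
          Real.hasDerivAt_rpow_const (Or.inl one_ne_zero)
        have q2 : HasDerivAt (fun t : ℝ => s / t) (-s) 1 := by
          have := (hasDerivAt_inv (one_ne_zero (α := ℝ))).const_mul s
          simpa [div_eq_mul_inv] using this
        have q3 : HasDerivAt (fun t : ℝ => φ (s / t)) (deriv φ s * (-s)) 1 := by
          refine HasDerivAt.comp (h₂ := φ) (h := fun t : ℝ => s / t) 1 ?_ q2
          simpa using hd1
        have q4 := (q1.mul q3).congr_of_eventuallyEq (f₁ := Φ (r • e))
          ((eventually_gt_nhds one_pos).mono fun t ht => by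
            rw [hrep _ hx0 t ht, hxn, hrk]
            simp only [Pi.mul_apply]
            congr 2
            field_simp)
        rw [q4.deriv]; simp; ring
      -- spatial part
      set h : ℝ → ℝ := fun q => φ ((1 / k ^ 2) * q ^ (k / 2)) with hh
      have hh2 : ContDiffOn ℝ 2 h (Ioi 0) := by
        refine hφ2.comp (t := Ioi 0) (f := fun q : ℝ => (1 / k ^ 2) * q ^ (k / 2)) ?_ ?_
        · refine contDiffOn_const.mul (ContDiffOn.rpow_const_of_ne contDiffOn_id ?_)
          intro s hs
          exact ne_of_gt hs
        · intro s hs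
          have : (0 : ℝ) < s := hs
          show (0 : ℝ) < (1 / k ^ 2) * s ^ (k / 2)
          positivity
      have hpw : ∀ u : ℝ, 0 < u → (u ^ 2) ^ (k / 2) = u ^ k := by
        intro u hu
        rw [← Real.rpow_natCast, ← Real.rpow_mul hu.le]
        congr 1; push_cast; ring
      have hL := ssc_lap (fun y => Φ y 1) h (fun y hy => by
        have : 0 < ‖y‖ := norm_pos_iff.2 hy
        simp only [hrep y hy 1 one_pos, hh, hpw _ this, Real.one_rpow]
        rw [one_mul]; congr 1; ring) hh2 (r • e) hx0
      rw [hxn] at hL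
      obtain ⟨c1, c2⟩ := ssc_chain φ h (1 / k ^ 2) (k / 2) (by positivity) hφ2
        (fun _ _ => rfl) (r ^ 2) (by positivity)
      have hs' : 1 / k ^ 2 * (r ^ 2) ^ (k / 2) = s := by
        rw [hpw r hr0, hrk]; field_simp
      rw [hs'] at c1 c2
      rw [hT, hL, hxn] at H
      have hra : r ^ α * (k ^ 2 * s) = r ^ 2 := by
        rw [← hrk, ← Real.rpow_add hr0, ← Real.rpow_natCast]
        congr 1; push_cast; linarith
      have hα : α = 2 - k := by linarith
      have e0 : (k ^ 2 * s) * (βt / k * φ s - s * deriv φ s) =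
          4 * (deriv (deriv φ) s * (k / 2 * s) ^ 2 + deriv φ s * (k / 2 * (k / 2 - 1) * s))
          + 2 * N * (deriv φ s * (k / 2 * s)) := by
        rw [← c1, ← c2, H]
        linear_combination (4 * r ^ 2 * deriv (deriv h) (r ^ 2) + 2 * N * deriv h (r ^ 2)) * hra
      have hks : k ^ 2 * s ≠ 0 := by positivity
      apply mul_left_cancel₀ hks
      have hdiv : ((N : ℝ) - α) / k * k = N - α := div_mul_cancel₀ _ hk.ne'
      rw [hα] at hdiv ⊢
      linear_combination -e0 + k * s * deriv φ s * hdiv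
    exact ⟨φ, ssc_boot φ _ _ hφ2 hode, hode, hrep⟩
  · rintro ⟨φ, -, -, hrep⟩ lam hl x hx t ht
    have hlx : lam • x ≠ 0 := smul_ne_zero hl.ne' hx
    have hlk : 0 < lam ^ k := by positivity
    rw [hrep x hx t ht, hrep _ hlx _ (by positivity), norm_smul, Real.norm_of_nonneg hl.le,
      Real.mul_rpow hl.le (norm_nonneg _), Real.mul_rpow hlk.le ht.le, ← Real.rpow_mul hl.le,
      mul_div_cancel₀ _ hk.ne', Real.rpow_neg hl.le]
    have : lam ^ k * ‖x‖ ^ k / (k ^ 2 * (lam ^ k * t)) = ‖x‖ ^ k / (k ^ 2 * t) := by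
      field_simp
    rw [this]
    have : 0 < lam ^ βt := by positivity
    field_simp
end
end

section
/- Let N ≥ 2, α ∈ [0,1), and β ∈ ℝ. Assume φ ∈ C²((0,∞)) satisfies s φ''(s) + ((N−α)/(2−α) + s) φ'(s) + β φ(s) = 0 for all s > 0, together with lim_{s↓0} φ(s) = 1. Then φ(s) = e^{−s} M((N−α)/(2−α) − β, (N−α)/(2−α); s) for all s > 0, where M is Kummer's confluent hypergeometric function of the first kind. -/
open Real MeasureTheory Filter Set

noncomputable section

open Topology in
lemma aux_pow_series (a : ℕ → ℝ) (ha : ∀ R : ℝ, Summable (fun n => |a n| * R ^ n)) :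
    (∀ R : ℝ, Summable (fun n : ℕ => |((n : ℝ) + 1) * a (n + 1)| * R ^ n)) ∧
    ∀ x : ℝ, HasDerivAt (fun y => ∑' n, a n * y ^ n)
      (∑' n : ℕ, ((n : ℝ) + 1) * a (n + 1) * x ^ n) x := by
  have key : ∀ R : ℝ, Summable (fun n : ℕ => |((n : ℝ) + 1) * a (n + 1)| * R ^ n) := by
    intro R
    have h1 : Summable (fun n : ℕ => |a (n + 1)| * (2 * (|R| + 1)) ^ (n + 1)) :=
      (summable_nat_add_iff 1).2 (ha (2 * (|R| + 1)))
    refine Summable.of_norm_bounded h1 ?_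
    intro n
    rw [norm_mul, norm_pow, Real.norm_eq_abs, Real.norm_eq_abs, abs_abs, abs_mul]
    have h2 : |(n : ℝ) + 1| ≤ 2 ^ (n + 1) := by
      rw [abs_of_nonneg (by positivity)]
      have : n + 1 < 2 ^ (n + 1) := Nat.lt_two_pow_self
      exact_mod_cast this.le
    have h3 : |R| ^ n ≤ (|R| + 1) ^ (n + 1) := by
      have hR := abs_nonneg R
      calc |R| ^ n ≤ (|R| + 1) ^ n := by gcongr; linarith
        _ ≤ (|R| + 1) ^ (n + 1) := pow_le_pow_right₀ (by linarith) (Nat.le_succ n)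
    calc |(n : ℝ) + 1| * |a (n + 1)| * |R| ^ n
        ≤ 2 ^ (n + 1) * |a (n + 1)| * (|R| + 1) ^ (n + 1) := by gcongr
      _ = _ := by rw [mul_pow]; ring
  refine ⟨key, fun x => ?_⟩
  set R := |x| + 1 with hR
  have hsum : Summable (fun n : ℕ => (n : ℝ) * |a n| * R ^ (n - 1)) := by
    rw [← summable_nat_add_iff 1]
    refine (key R).congr ?_
    intro n
    simp only [Nat.add_sub_cancel]
    rw [abs_mul, abs_of_nonneg (by positivity : (0 : ℝ) ≤ (n : ℝ) + 1)]
    push_cast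
    ring
  have hd := hasDerivAt_tsum_of_isPreconnected (𝕜 := ℝ) (F := ℝ) (t := Metric.ball (0 : ℝ) R)
    (g := fun n y => a n * y ^ n) (g' := fun n y => a n * ((n : ℝ) * y ^ (n - 1)))
    (y₀ := 0) (y := x) hsum Metric.isOpen_ball (convex_ball (0 : ℝ) R).isPreconnected
    (fun n y _ => (hasDerivAt_pow n y).const_mul (a n))
    (fun n y hy => by
      rw [mem_ball_zero_iff, Real.norm_eq_abs] at hy
      rw [Real.norm_eq_abs, abs_mul, abs_mul, abs_pow, Nat.abs_cast]
      calc |a n| * ((n : ℝ) * |y| ^ (n - 1)) ≤ |a n| * ((n : ℝ) * R ^ (n - 1)) := by gcongr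
        _ = _ := by ring)
    (by simp; positivity)
    (by
      refine Summable.of_norm ((ha 0).congr ?_)
      intro n
      rw [norm_mul, norm_pow, norm_zero, Real.norm_eq_abs])
    (by simp [hR])
  have hs2 : Summable (fun n : ℕ => a n * ((n : ℝ) * x ^ (n - 1))) := by
    refine Summable.of_norm_bounded hsum ?_
    intro n
    rw [Real.norm_eq_abs, abs_mul, abs_mul, abs_pow, Nat.abs_cast]
    have : |x| ≤ R := by linarith
    calc |a n| * ((n : ℝ) * |x| ^ (n - 1)) ≤ |a n| * ((n : ℝ) * R ^ (n - 1)) := by gcongr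
        _ = _ := by ring
  refine hd.congr_deriv ?_
  rw [hs2.tsum_eq_zero_add]
  simp only [Nat.cast_zero, zero_mul, mul_zero, zero_add, Nat.add_sub_cancel]
  refine tsum_congr fun n => ?_
  push_cast
  ring

lemma aux_summ (a : ℕ → ℝ) (ha : ∀ R : ℝ, Summable (fun n => |a n| * R ^ n)) (x : ℝ) :
    Summable (fun n => a n * x ^ n) := by
  refine Summable.of_norm ((ha |x|).congr ?_)
  intro n
  rw [norm_mul, norm_pow, Real.norm_eq_abs, Real.norm_eq_abs]

/-- `x f'(x) = ∑ n a_n x^n`, as a `HasSum`. -/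
lemma aux_xderiv (a : ℕ → ℝ) (ha : ∀ R : ℝ, Summable (fun n => |a n| * R ^ n)) (x : ℝ) :
    HasSum (fun n : ℕ => (n : ℝ) * a n * x ^ n)
      (x * ∑' n : ℕ, ((n : ℝ) + 1) * a (n + 1) * x ^ n) := by
  have h := (aux_summ _ (aux_pow_series a ha).1 x).hasSum.mul_left x
  rw [← hasSum_nat_add_iff' 1]
  simp only [Finset.range_one, Finset.sum_singleton, Nat.cast_zero, zero_mul, sub_zero]
  refine h.congr_fun ?_ 
  intro n
  push_cast
  ring

lemma aux_kummer (b c : ℝ) (hc : 0 < c) : ∃ M1 M2 : ℝ → ℝ,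
    (∀ x, HasDerivAt (kummerM b c) (M1 x) x) ∧ (∀ x, HasDerivAt M1 (M2 x) x) ∧
    (∀ x, x * M2 x + (c - x) * M1 x - b * kummerM b c x = 0) ∧ kummerM b c 0 = 1 := by
  set a : ℕ → ℝ := fun n =>
    ((∏ k ∈ Finset.range n, (b + (k : ℝ))) / (∏ k ∈ Finset.range n, (c + (k : ℝ))))
      / (n.factorial : ℝ) with haa
  have hrec : ∀ n : ℕ, (n + c) * ((n + 1) * a (n + 1)) = (n + b) * a n := by
    intro n
    have h1 : (∏ k ∈ Finset.range n, (c + (k : ℝ))) ≠ 0 :=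
      Finset.prod_ne_zero_iff.2 fun k _ => by positivity
    have h2 : (n.factorial : ℝ) ≠ 0 := by positivity
    have h3 : c + (n : ℝ) ≠ 0 := by positivity
    have h4 : (n : ℝ) + 1 ≠ 0 := by positivity
    simp only [haa, Finset.prod_range_succ, Nat.factorial_succ]
    push_cast
    field_simp
    ring
  have hM : kummerM b c = fun y => ∑' n, a n * y ^ n := by
    funext y
    unfold kummerM
    refine tsum_congr fun n => ?_
    simp only [haa]
    ring
  have ha : ∀ R : ℝ, Summable (fun n => |a n| * R ^ n) := by
    intro R
    obtain ⟨m, hm⟩ := exists_nat_gt (2 * |R| * (1 + |b| / c))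
    refine summable_of_ratio_norm_eventually_le (r := 1 / 2) (by norm_num) ?_
    filter_upwards [eventually_ge_atTop m] with n hn
    have hn' : (m : ℝ) ≤ n := by exact_mod_cast hn
    have hnc : 0 < (n : ℝ) + c := by positivity
    have hE : a (n + 1) = (n + b) / (n + c) / (n + 1) * a n := by
      have := hrec n
      field_simp
      linarith
    have hq : |((n : ℝ) + b) / (n + c)| ≤ 1 + |b| / c := by
      rw [abs_div, abs_of_pos hnc, div_le_iff₀ hnc]
      have h5 : |(n : ℝ) + b| ≤ n + |b| := by
        calc |(n : ℝ) + b| ≤ |(n : ℝ)| + |b| := abs_add_le _ _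
          _ = _ := by rw [Nat.abs_cast]
      have h6 : |b| / c * c = |b| := by field_simp
      have h7 : 0 ≤ |b| / c * n := by positivity
      nlinarith
    rw [norm_mul, norm_mul, norm_pow, norm_pow, Real.norm_eq_abs, Real.norm_eq_abs, Real.norm_eq_abs,
      abs_abs, abs_abs, hE, abs_mul, abs_div, abs_of_pos (by positivity : (0 : ℝ) < (n : ℝ) + 1)]
    have h8 : |((n : ℝ) + b) / (n + c)| / (n + 1) * |R| ≤ 1 / 2 := by
      rw [div_mul_eq_mul_div, div_le_iff₀ (by positivity)]
      have : |((n : ℝ) + b) / (n + c)| * |R| ≤ (1 + |b| / c) * |R| := by gcongr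
      linarith
    calc _ = (|((n : ℝ) + b) / (n + c)| / (n + 1) * |R|) * (|a n| * |R| ^ n) := by ring
      _ ≤ _ := by gcongr
  obtain ⟨hd, hM1⟩ := aux_pow_series a ha
  obtain ⟨_, hM2⟩ := aux_pow_series _ hd
  refine ⟨_, _, by rw [hM]; exact hM1, hM2, ?_, ?_⟩
  · intro x
    have s1 := aux_xderiv a ha x
    have s2 := aux_xderiv _ hd x
    have s3 := (aux_summ _ hd x).hasSum
    have s4 := (aux_summ _ ha x).hasSum
    have := ((s2.add (s3.mul_left c)).sub (s1.add (s4.mul_left b)))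
    have h0 := this.unique (by
      convert hasSum_zero using 1
      funext n
      have := hrec n
      linear_combination x ^ n * this)
    rw [hM]
    simp only
    linear_combination h0
  · rw [hM]
    simp only
    rw [tsum_eq_single 0]
    · simp [haa]
    · intro n hn
      simp [hn]

open Topology in
lemma aux_unique (c β : ℝ) (hc : 1 ≤ c) (w w1 w2 p p1 p2 : ℝ → ℝ)
    (hw : ∀ s, 0 < s → HasDerivAt w (w1 s) s) (hw1 : ∀ s, 0 < s → HasDerivAt w1 (w2 s) s)
    (hp : ∀ s, 0 < s → HasDerivAt p (p1 s) s) (hp1 : ∀ s, 0 < s → HasDerivAt p1 (p2 s) s)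
    (ew : ∀ s, 0 < s → s * w2 s + (c + s) * w1 s + β * w s = 0)
    (ep : ∀ s, 0 < s → s * p2 s + (c + s) * p1 s + β * p s = 0)
    (lw : Tendsto w (𝓝[>] 0) (𝓝 0)) (lp : Tendsto p (𝓝[>] 0) (𝓝 1)) :
    ∀ s, 0 < s → w s = 0 := by
  -- Wronskian
  set W : ℝ → ℝ := fun s => s ^ c * Real.exp s * (w1 s * p s - w s * p1 s) with hW
  have hWd : ∀ s, 0 < s → HasDerivAt W 0 s := by
    intro s hs
    have h1 := ((Real.hasDerivAt_rpow_const (p := c) (Or.inl hs.ne')).mul (Real.hasDerivAt_exp s)).mul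
      (((hw1 s hs).mul (hp s hs)).sub ((hw s hs).mul (hp1 s hs)))
    refine h1.congr_deriv ?_
    have e1 := ew s hs
    have e2 := ep s hs
    have h2 : s ^ c = s ^ (c - 1) * s := by
      rw [← Real.rpow_add_one hs.ne']; congr 1; ring
    simp only [Pi.mul_apply, Pi.sub_apply]
    rw [h2]
    linear_combination (s ^ (c - 1) * Real.exp s) * (p s * e1 - w s * e2)
  obtain ⟨K, hK⟩ : ∃ K, ∀ s, 0 < s → W s = K := by
    refine ⟨W 1, fun s hs => ?_⟩
    refine (convex_Ioi (0 : ℝ)).is_const_of_fderivWithin_eq_zero (𝕜 := ℝ) (f := W) ?_ ?_ hs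
      (by simp : (1 : ℝ) ∈ Ioi (0 : ℝ))
    · exact fun x hx => (hWd x hx).differentiableAt.differentiableWithinAt
    · intro x hx
      rw [fderivWithin_of_isOpen isOpen_Ioi hx]
      have := (hWd x hx).hasFDerivAt.fderiv
      rw [this]; ext; simp
  -- neighbourhood
  obtain ⟨δ, hδ0, hδ⟩ : ∃ δ > 0, ∀ s, 0 < s → s ≤ δ → s ≤ 1 ∧ 1 / 2 < p s ∧ p s < 2 := by
    have h := (lp.eventually (Ioo_mem_nhds (by norm_num : (1 / 2 : ℝ) < 1) (by norm_num : (1 : ℝ) < 2)))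
    rw [eventually_nhdsWithin_iff, Metric.eventually_nhds_iff] at h
    obtain ⟨ε, hε, h⟩ := h
    refine ⟨min 1 (ε / 2), by positivity, fun s hs hs' => ?_⟩
    have h1 := (le_min_iff.1 hs').1
    have h2 := (le_min_iff.1 hs').2
    have := h (y := s) (by rw [Real.dist_eq, sub_zero, abs_of_pos hs]; linarith) hs
    exact ⟨h1, this.1, this.2⟩
  have hq : ∀ s, 0 < s → s ≤ δ → HasDerivAt (fun s => w s / p s) (K / (s ^ c * Real.exp s * p s ^ 2)) s := by
    intro s hs hs'
    have hps : p s ≠ 0 := by linarith [(hδ s hs hs').2.1]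
    refine ((hw s hs).div (hp s hs) hps).congr_deriv ?_
    rw [← hK s hs]
    have : s ^ c ≠ 0 := (Real.rpow_pos_of_pos hs c).ne'
    simp only [hW]
    field_simp
  have lq : Tendsto (fun s => w s / p s) (𝓝[>] 0) (𝓝 0) := by
    have h := lw.div lp one_ne_zero
    rw [zero_div] at h
    exact h
  have hK0 : K = 0 := by
    by_contra hKne
    set k0 : ℝ := K ^ 2 / (4 * Real.exp 1) with hk0
    have hk0pos : 0 < k0 := by positivity
    have hmono : MonotoneOn (fun s => K * (w s / p s) - k0 * Real.log s) (Ioc 0 δ) := by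
      have hder : ∀ s ∈ Ioc 0 δ, HasDerivAt (fun s => K * (w s / p s) - k0 * Real.log s)
          (K * (K / (s ^ c * Real.exp s * p s ^ 2)) - k0 * s⁻¹) s := fun s hs =>
        ((hq s hs.1 hs.2).const_mul K).sub ((Real.hasDerivAt_log hs.1.ne').const_mul k0)
      refine monotoneOn_of_hasDerivWithinAt_nonneg (convex_Ioc 0 δ)
        (fun s hs => (hder s hs).continuousAt.continuousWithinAt)
        (fun s hs => (hder s (interior_subset hs)).hasDerivWithinAt) ?_
      intro s hs
      have hs := interior_subset hs
      obtain ⟨h1, h2, h3⟩ := hδ s hs.1 hs.2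
      have hs0 : 0 < s := hs.1
      have hb : s ^ c * Real.exp s * p s ^ 2 ≤ s * Real.exp 1 * 4 := by
        have : s ^ c ≤ s := by
          simpa using Real.rpow_le_rpow_of_exponent_ge hs0 h1 hc
        have h4 : p s ^ 2 ≤ 4 := by nlinarith
        have h5 : Real.exp s ≤ Real.exp 1 := Real.exp_le_exp.2 h1
        gcongr
      have hpos : 0 < s ^ c * Real.exp s * p s ^ 2 := by
        have := Real.rpow_pos_of_pos hs0 c
        have : 0 < p s := by linarith
        positivity
      have : K ^ 2 / (s * Real.exp 1 * 4) ≤ K ^ 2 / (s ^ c * Real.exp s * p s ^ 2) := by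
        gcongr
      have e : k0 * s⁻¹ = K ^ 2 / (s * Real.exp 1 * 4) := by
        rw [hk0]; field_simp
      have e' : K * (K / (s ^ c * Real.exp s * p s ^ 2)) = K ^ 2 / (s ^ c * Real.exp s * p s ^ 2) := by
        ring
      linarith
    have ht : Tendsto (fun s => K * (w s / p s) - k0 * Real.log s) (𝓝[>] 0) atTop := by
      have h1 : Tendsto (fun s => -(k0 * Real.log s)) (𝓝[>] 0) atTop :=
        tendsto_neg_atBot_atTop.comp (Real.tendsto_log_nhdsGT_zero.const_mul_atBot hk0pos)
      simpa [sub_eq_add_neg] using (lq.const_mul K).add_atTop h1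
    have hev := ht.eventually_gt_atTop (K * (w δ / p δ) - k0 * Real.log δ)
    obtain ⟨s, hs1, hs2⟩ := (hev.and (Ioc_mem_nhdsGT hδ0)).exists
    have := hmono hs2 ⟨hδ0, le_rfl⟩ hs2.2
    simp only at this
    linarith
  -- w vanishes near zero
  have hz : ∀ s, 0 < s → s ≤ δ → w s = 0 := by
    intro s hs hs'
    have hconst : ∀ t ∈ Ioc 0 δ, w t / p t = w s / p s := by
      intro t ht
      refine (convex_Ioc (0 : ℝ) δ).is_const_of_fderivWithin_eq_zero (𝕜 := ℝ)
        (f := fun s => w s / p s) ?_ ?_ ht ⟨hs, hs'⟩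
      · exact fun x hx => (hq x hx.1 hx.2).differentiableAt.differentiableWithinAt
      · intro x hx
        have h1 := (hq x hx.1 hx.2)
        rw [hK0, zero_div] at h1
        rw [fderivWithin_eq_fderiv (uniqueDiffOn_Ioc 0 δ x hx) h1.differentiableAt,
          h1.hasFDerivAt.fderiv]
        ext; simp
    have h2 : Tendsto (fun s => w s / p s) (𝓝[>] 0) (𝓝 (w s / p s)) :=
      tendsto_const_nhds.congr' (by
        filter_upwards [Ioc_mem_nhdsGT hδ0] with t ht using (hconst t ht).symm)
    have h3 := tendsto_nhds_unique lq h2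
    have hps : p s ≠ 0 := by linarith [(hδ s hs hs').2.1]
    rcases div_eq_zero_iff.1 h3.symm with h | h
    · exact h
    · exact absurd h hps
  intro s hs
  by_cases hs' : s ≤ δ
  · exact hz s hs hs'
  push Not at hs'
  set r := δ / 2 with hr
  have hr0 : 0 < r := by positivity
  have hrδ : r < δ := by linarith
  have hwr : w r = 0 := hz r hr0 hrδ.le
  have hw1r : w1 r = 0 := by
    have h1 : w =ᶠ[𝓝 r] fun _ => 0 := by
      filter_upwards [Ioo_mem_nhds hr0 hrδ] with t ht using hz t ht.1 ht.2.le
    exact (hw r hr0).unique ((hasDerivAt_const r (0 : ℝ)).congr_of_eventuallyEq h1)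
  set C : ℝ := 1 + |β| / r with hC
  have hder : ∀ t ∈ Ici r, HasDerivAt (fun t => (w t ^ 2 + w1 t ^ 2) * Real.exp (-C * t))
      ((2 * w t * w1 t + 2 * w1 t * w2 t - C * (w t ^ 2 + w1 t ^ 2)) * Real.exp (-C * t)) t := by
    intro t ht
    have ht0 : 0 < t := lt_of_lt_of_le hr0 ht
    have h1 := (((hw t ht0).pow 2).add ((hw1 t ht0).pow 2)).mul
      (((hasDerivAt_id t).const_mul (-C)).exp)
    refine h1.congr_deriv ?_
    simp
    ring
  have hanti : AntitoneOn (fun t => (w t ^ 2 + w1 t ^ 2) * Real.exp (-C * t)) (Ici r) := by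
    refine antitoneOn_of_hasDerivWithinAt_nonpos (convex_Ici r)
      (fun t ht => (hder t ht).continuousAt.continuousWithinAt)
      (fun t ht => (hder t (interior_subset ht)).hasDerivWithinAt) ?_
    intro t ht
    have ht : r ≤ t := interior_subset ht
    have ht0 : 0 < t := lt_of_lt_of_le hr0 ht
    refine mul_nonpos_of_nonpos_of_nonneg ?_ (Real.exp_pos _).le
    have e : w2 t = -((c + t) / t * w1 t) - β / t * w t := by
      have := ew t ht0
      field_simp
      linarith
    have hA : 0 ≤ (c + t) / t := by positivity
    have hB : |β / t| ≤ |β| / r := by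
      rw [abs_div, abs_of_pos ht0]; gcongr
    have h1 : 2 * w t * w1 t ≤ w t ^ 2 + w1 t ^ 2 := two_mul_le_add_sq _ _
    have h2 : 2 * |w t * w1 t| ≤ w t ^ 2 + w1 t ^ 2 := by
      rw [abs_mul]
      have := two_mul_le_add_sq |w t| |w1 t|
      rw [sq_abs, sq_abs] at this
      linarith
    have h3 : -(2 * (β / t) * (w t * w1 t)) ≤ |β| / r * (w t ^ 2 + w1 t ^ 2) := by
      calc -(2 * (β / t) * (w t * w1 t)) ≤ |2 * (β / t) * (w t * w1 t)| := neg_le_abs _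
        _ = |β / t| * (2 * |w t * w1 t|) := by rw [abs_mul, abs_mul, abs_two]; ring
        _ ≤ _ := by gcongr
    have h4 : 0 ≤ (c + t) / t * w1 t ^ 2 := by positivity
    rw [e, hC]
    nlinarith
  have hfin := hanti (show r ∈ Ici r from le_refl r) (show s ∈ Ici r from (by linarith : r ≤ s)) (by linarith : r ≤ s)
  simp only [hwr, hw1r] at hfin
  have hx := Real.exp_pos (-C * s)
  have : w s ^ 2 + w1 s ^ 2 ≤ 0 := by
    by_contra hcon
    push Not at hcon
    have := mul_pos hcon hx
    norm_num at hfin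
    norm_num at this
    linarith
  have h5 : w s ^ 2 = 0 := by nlinarith [sq_nonneg (w s), sq_nonneg (w1 s)]
  exact pow_eq_zero_iff (two_ne_zero) |>.1 h5

/-- Lemma 2.2. If `φ ∈ C²((0,∞))` satisfies
`s φ'' + ((N−α)/(2−α) + s) φ' + β φ = 0` on `(0,∞)` with `φ(s) → 1` as `s ↓ 0`, then
`φ(s) = e^{−s} M((N−α)/(2−α) − β, (N−α)/(2−α); s)`. -/
theorem ode_solution_is_kummer
    (N : ℕ) (hN : 2 ≤ N) (α : ℝ) (hα0 : 0 ≤ α) (hα1 : α < 1) (β : ℝ)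
    (φ : ℝ → ℝ) (hreg : ContDiffOn ℝ 2 φ (Ioi 0))
    (hode : ∀ s : ℝ, 0 < s →
      s * deriv (deriv φ) s + (((N : ℝ) - α) / (2 - α) + s) * deriv φ s + β * φ s = 0)
    (hlim : Tendsto φ (nhdsWithin 0 (Ioi 0)) (nhds 1)) :
    ∀ s : ℝ, 0 < s →
      φ s = Real.exp (-s) *
        kummerM (((N : ℝ) - α) / (2 - α) - β) (((N : ℝ) - α) / (2 - α)) s := by
  have hc : 1 ≤ ((N : ℝ) - α) / (2 - α) := by
    have : (2 : ℝ) ≤ N := by exact_mod_cast hN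
    rw [le_div_iff₀ (by linarith)]
    linarith
  set c := ((N : ℝ) - α) / (2 - α) with hcdef
  obtain ⟨M1, M2, hM, hM1, eM, hM0⟩ := aux_kummer (c - β) c (by linarith)
  set M := kummerM (c - β) c with hMdef
  have hφ : ∀ s, 0 < s → HasDerivAt φ (deriv φ s) s := fun s hs =>
    ((hreg.differentiableOn (by norm_num)).differentiableAt (Ioi_mem_nhds hs)).hasDerivAt
  have hφ1 : ∀ s, 0 < s → HasDerivAt (deriv φ) (deriv (deriv φ) s) s := fun s hs =>
    (((hreg.deriv_of_isOpen (m := 1) isOpen_Ioi (by norm_num)).differentiableOn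
      (by norm_num)).differentiableAt (Ioi_mem_nhds hs)).hasDerivAt
  have hexp : ∀ s : ℝ, HasDerivAt (fun s : ℝ => Real.exp (-s)) (-Real.exp (-s)) s := fun s => by
    simpa using (hasDerivAt_neg s).exp
  have hp : ∀ s : ℝ, HasDerivAt (fun s => Real.exp (-s) * M s) (Real.exp (-s) * (M1 s - M s)) s :=
    fun s => ((hexp s).mul (hM s)).congr_deriv (by ring)
  have hp1 : ∀ s : ℝ, HasDerivAt (fun s => Real.exp (-s) * (M1 s - M s))
      (Real.exp (-s) * (M2 s - 2 * M1 s + M s)) s :=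
    fun s => ((hexp s).mul ((hM1 s).sub (hM s))).congr_deriv (by simp only [Pi.sub_apply]; ring)
  have ep : ∀ s : ℝ, s * (Real.exp (-s) * (M2 s - 2 * M1 s + M s)) +
      (c + s) * (Real.exp (-s) * (M1 s - M s)) + β * (Real.exp (-s) * M s) = 0 := fun s => by
    linear_combination Real.exp (-s) * eM s
  have lp : Tendsto (fun s => Real.exp (-s) * M s) (nhdsWithin 0 (Ioi 0)) (nhds 1) := by
    have := (hp 0).continuousAt.tendsto
    simp only [neg_zero, Real.exp_zero, hM0, mul_one] at this
    exact this.mono_left nhdsWithin_le_nhds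
  intro s hs
  have := aux_unique c β hc (fun s => φ s - Real.exp (-s) * M s)
    (fun s => deriv φ s - Real.exp (-s) * (M1 s - M s))
    (fun s => deriv (deriv φ) s - Real.exp (-s) * (M2 s - 2 * M1 s + M s)) _ _ _
    (fun s hs => (hφ s hs).sub (hp s)) (fun s hs => (hφ1 s hs).sub (hp1 s))
    (fun s _ => hp s) (fun s _ => hp1 s)
    (fun s hs => by
      linear_combination hode s hs - ep s) (fun s _ => ep s)
    (by simpa using hlim.sub lp) lp s hs
  linarith
end
end

section
/- Let N ≥ 2 and α ∈ [0,1). For every β < (N−α)/(2−α) there exists a constant c_β > 0 such that φ_β(s) ≥ c_β (1+s)^{−β} for all s ≥ 0; in particular φ_β(s) > 0 for all s ≥ 0. -/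
open Real MeasureTheory Filter Set

noncomputable section

theorem aux_coef_bdd (b c : ℝ) (hb : 0 < b) (hc : 0 < c) :
    ∃ K : ℝ, 0 < K ∧ ∀ n : ℕ, K * (1 + (n : ℝ)) ^ (b - c) ≤
      (∏ k ∈ Finset.range n, (b + (k : ℝ))) / (∏ k ∈ Finset.range n, (c + (k : ℝ))) := by
  set v : ℕ → ℝ := fun n => (1 + (n : ℝ)) ^ (b - c) *
    ((∏ k ∈ Finset.range n, (c + (k : ℝ))) / (∏ k ∈ Finset.range n, (b + (k : ℝ)))) with hv
  have hPb : ∀ n : ℕ, 0 < ∏ k ∈ Finset.range n, (b + (k : ℝ)) :=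
    fun n => Finset.prod_pos (fun k _ => by positivity)
  have hPc : ∀ n : ℕ, 0 < ∏ k ∈ Finset.range n, (c + (k : ℝ)) :=
    fun n => Finset.prod_pos (fun k _ => by positivity)
  have h1 : Tendsto (fun n : ℕ => (1 + 2 / (n : ℝ)) ^ (b - c)) atTop (nhds 1) := by
    have h : Tendsto (fun n : ℕ => 1 + 2 / (n : ℝ)) atTop (nhds (1 + 0)) :=
      tendsto_const_nhds.add (tendsto_const_div_atTop_nhds_zero_nat 2)
    have h2 := h.rpow_const (p := b - c) (Or.inl (by norm_num))
    simpa using h2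
  have h2 : Tendsto (fun n : ℕ => (1 + 2 / (n : ℝ)) ^ (b - c) *
      (Real.GammaSeq b n / Real.GammaSeq c n)) atTop
      (nhds (1 * (Real.Gamma b / Real.Gamma c))) :=
    h1.mul ((Real.GammaSeq_tendsto_Gamma b).div (Real.GammaSeq_tendsto_Gamma c)
      (Real.Gamma_pos_of_pos hc).ne')
  have h3 : Tendsto (fun n => v (n + 1)) atTop (nhds (1 * (Real.Gamma b / Real.Gamma c))) := by
    refine h2.congr' ?_
    filter_upwards [eventually_gt_atTop 0] with n hn
    have hn' : (0 : ℝ) < n := by exact_mod_cast hn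
    have e1 : (1 + ((n + 1 : ℕ) : ℝ)) = (1 + 2 / (n : ℝ)) * n := by
      push_cast; field_simp; ring
    have hb' := hPb (n + 1)
    have hc' := hPc (n + 1)
    have hf : (0 : ℝ) < (n.factorial : ℝ) := by exact_mod_cast n.factorial_pos
    simp only [hv]
    rw [e1, Real.mul_rpow (by positivity) hn'.le, Real.GammaSeq, Real.GammaSeq,
      Real.rpow_sub hn' b c]
    have hnb : (0 : ℝ) < (n : ℝ) ^ b := by positivity
    have hnc : (0 : ℝ) < (n : ℝ) ^ c := by positivity
    field_simp
  have h4 : Tendsto v atTop (nhds (1 * (Real.Gamma b / Real.Gamma c))) :=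
    (tendsto_add_atTop_iff_nat 1).1 h3
  obtain ⟨M, hM⟩ := h4.bddAbove_range
  have hM' : ∀ n, v n ≤ M := fun n => hM ⟨n, rfl⟩
  have hvpos : ∀ n, 0 < v n := fun n =>
    mul_pos (by positivity) (div_pos (hPc n) (hPb n))
  have hMpos : 0 < M := (hvpos 0).trans_le (hM' 0)
  refine ⟨M⁻¹, inv_pos.2 hMpos, fun n => ?_⟩
  have h := hM' n
  simp only [hv] at h
  have hb' := hPb n
  have hc' := hPc n
  rw [← mul_div_assoc, div_le_iff₀ hb'] at h
  rw [le_div_iff₀ hc', inv_mul_eq_div, div_mul_eq_mul_div, div_le_iff₀ hMpos]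
  linarith

theorem aux_summable (b c s : ℝ) (hb : 0 < b) (hc : 0 < c) (hs : 0 ≤ s) :
    Summable (fun n : ℕ =>
      ((∏ k ∈ Finset.range n, (b + (k : ℝ))) / (∏ k ∈ Finset.range n, (c + (k : ℝ))))
      * s ^ n / (n.factorial : ℝ)) := by
  refine Summable.of_nonneg_of_le (fun n => ?_) (fun n => ?_)
    (Real.summable_pow_div_factorial ((1 + b / c) * s))
  · have h1 : 0 ≤ ∏ k ∈ Finset.range n, (b + (k : ℝ)) :=
      Finset.prod_nonneg (fun k _ => by positivity)
    have h2 : 0 ≤ ∏ k ∈ Finset.range n, (c + (k : ℝ)) :=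
      Finset.prod_nonneg (fun k _ => by positivity)
    positivity
  · rw [mul_pow, ← Finset.prod_div_distrib]
    have : ∏ k ∈ Finset.range n, ((b + (k : ℝ)) / (c + (k : ℝ))) ≤ (1 + b / c) ^ n := by
      calc _ ≤ ∏ k ∈ Finset.range n, (1 + b / c) := by
            refine Finset.prod_le_prod (fun k _ => by positivity) (fun k _ => ?_)
            rw [div_le_iff₀ (by positivity)]
            have : (1 + b / c) * (c + k) = b + k + (c + b / c * k) := by field_simp; ring
            rw [this]
            have : 0 ≤ c + b / c * k := by positivity
            linarith
        _ = _ := by simp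
    gcongr

theorem aux_shift (h : ℕ → ℝ) (s x : ℝ)
    (hx : HasSum (fun n : ℕ => h (n + 1) * (s ^ n / (n.factorial : ℝ))) x) :
    HasSum (fun n : ℕ => n * h n * (s ^ n / (n.factorial : ℝ))) (s * x) := by
  rw [← hasSum_nat_add_iff' 1]
  simp only [Finset.range_one, Finset.sum_singleton, Nat.cast_zero, zero_mul, sub_zero]
  convert! hx.mul_left s using 1
  funext n
  have hf : (0 : ℝ) < (n.factorial : ℝ) := by exact_mod_cast n.factorial_pos
  rw [Nat.factorial_succ]
  push_cast
  field_simp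
  ring

theorem aux_quad (s A B D : ℝ) (hs : 0 ≤ s) :
    HasSum (fun n : ℕ => (A + B * ((1 + n) / (1 + s)) + D * ((1 + n) / (1 + s)) ^ 2) *
      (s ^ n / (n.factorial : ℝ)))
      ((A + B + D * (1 + s / (1 + s) ^ 2)) * Real.exp s) := by
  have h0 : HasSum (fun n : ℕ => s ^ n / (n.factorial : ℝ)) (Real.exp s) := by
    rw [Real.exp_eq_exp_ℝ]
    exact NormedSpace.expSeries_div_hasSum_exp s
  have h1 := aux_shift (fun _ => 1) s _ (by simpa using h0)
  have h2 := aux_shift (fun n => n) s (s * Real.exp s + Real.exp s) (by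
    convert! h1.add h0 using 1
    funext n
    push_cast
    ring)
  have hs1 : 1 + s ≠ 0 := by positivity
  have h3 := ((h0.mul_left (A + B / (1 + s) + D / (1 + s) ^ 2)).add
    (h1.mul_left (B / (1 + s) + 2 * D / (1 + s) ^ 2))).add (h2.mul_left (D / (1 + s) ^ 2))
  convert! h3 using 1
  · funext n
    field_simp
    ring
  · field_simp
    ring

theorem aux_pointwise (p : ℝ) : ∃ A B D : ℝ, D ≤ 0 ∧ 0 < A + B + D * (5 / 4) ∧
    ∀ t : ℝ, 0 < t → A + B * t + D * t ^ 2 ≤ t ^ p := by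
  rcases le_or_gt p 0 with hp | hp
  · refine ⟨1 - p, p, 0, le_rfl, by norm_num, fun t ht => ?_⟩
    rw [Real.rpow_def_of_pos ht]
    have h1 := Real.add_one_le_exp (Real.log t * p)
    have h2 := Real.log_le_sub_one_of_pos ht
    nlinarith
  rcases le_or_gt 1 p with hp1 | hp1
  · refine ⟨1 - p, p, 0, le_rfl, by norm_num, fun t ht => ?_⟩
    have h := one_add_mul_self_le_rpow_one_add (s := t - 1) (by linarith) hp1
    have e : 1 + (t - 1) = t := by ring
    rw [e] at h
    linarith
  · refine ⟨0, 1, -(1 / 4), by norm_num, by norm_num, fun t ht => ?_⟩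
    rcases le_or_gt t 1 with h | h
    · have := Real.rpow_le_rpow_of_exponent_ge ht h hp1.le
      rw [Real.rpow_one] at this
      nlinarith [sq_nonneg t]
    · have := Real.one_le_rpow h.le hp.le
      nlinarith [sq_nonneg (t / 2 - 1)]

theorem aux_main (b c : ℝ) (hb : 0 < b) (hc : 0 < c) :
    ∃ K : ℝ, 0 < K ∧ ∀ s : ℝ, 0 ≤ s →
      K * (1 + s) ^ (b - c) ≤ Real.exp (-s) * kummerM b c s := by
  obtain ⟨K, hK, hKn⟩ := aux_coef_bdd b c hb hc
  obtain ⟨A, B, D, hD, hpos, hq⟩ := aux_pointwise (b - c)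
  refine ⟨K * (A + B + D * (5 / 4)), by positivity, fun s hs => ?_⟩
  have hS := (aux_quad s A B D hs).mul_left (K * (1 + s) ^ (b - c))
  have hle := hasSum_le (fun n => ?_) hS (aux_summable b c s hb hc hs).hasSum
  · change _ ≤ kummerM b c s at hle
    have hfrac : s / (1 + s) ^ 2 ≤ 1 / 4 := by
      rw [div_le_iff₀ (by positivity)]
      nlinarith [sq_nonneg (1 - s)]
    calc K * (A + B + D * (5 / 4)) * (1 + s) ^ (b - c)
        ≤ K * (1 + s) ^ (b - c) * (A + B + D * (1 + s / (1 + s) ^ 2)) := by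
          rw [mul_right_comm]
          refine mul_le_mul_of_nonneg_left ?_ (by positivity)
          nlinarith
      _ = Real.exp (-s) * (K * (1 + s) ^ (b - c) *
            ((A + B + D * (1 + s / (1 + s) ^ 2)) * Real.exp s)) := by
          rw [Real.exp_neg]
          field_simp
      _ ≤ _ := mul_le_mul_of_nonneg_left hle (Real.exp_pos _).le
  · have ht : (0 : ℝ) < (1 + n) / (1 + s) := by positivity
    have h1 := hq _ ht
    rw [Real.div_rpow (by positivity) (by positivity)] at h1
    have hw : (0 : ℝ) < (1 + s) ^ (b - c) := by positivity
    rw [le_div_iff₀ hw] at h1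
    have h2 := hKn n
    rw [← mul_assoc, mul_div_assoc]
    refine mul_le_mul_of_nonneg_right (le_trans ?_ h2) (by positivity)
    rw [mul_assoc]
    refine mul_le_mul_of_nonneg_left ?_ hK.le
    linarith

/-- Lemma 2.4 (iv). For every `β < (N−α)/(2−α)` there is `c_β > 0` with
`φ_β(s) ≥ c_β (1+s)^{−β}` for all `s ≥ 0`; in particular `φ_β(s) > 0` for all `s ≥ 0`. -/
theorem phiK_lower_bound
    (N : ℕ) (hN : 2 ≤ N) (α : ℝ) (hα0 : 0 ≤ α) (hα1 : α < 1) (β : ℝ)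
    (hβ : β < ((N : ℝ) - α) / (2 - α)) :
    ∃ c : ℝ, 0 < c ∧ (∀ s : ℝ, 0 ≤ s → c * (1 + s) ^ (-β) ≤ phiK N α β s)
      ∧ (∀ s : ℝ, 0 ≤ s → 0 < phiK N α β s) := by
  have hc : 0 < ((N : ℝ) - α) / (2 - α) := by
    have : (2 : ℝ) ≤ N := by exact_mod_cast hN
    exact div_pos (by linarith) (by linarith)
  obtain ⟨K, hK, h⟩ := aux_main (((N : ℝ) - α) / (2 - α) - β) _ (sub_pos.2 hβ) hc
  have h' : ∀ s : ℝ, 0 ≤ s → K * (1 + s) ^ (-β) ≤ phiK N α β s := by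
    intro s hs
    have := h s hs
    rw [sub_sub_cancel_left] at this
    exact this
  refine ⟨K, hK, h', fun s hs => lt_of_lt_of_le ?_ (h' s hs)⟩
  positivity
end
end

section
/- Let N ≥ 2 and α ∈ [0,1). For every β ∈ ℝ, the function Φ_β satisfies ∂_t Φ_β(x,t) = |x|^α Δ Φ_β(x,t) for all x ∈ ℝ^N ∖ {0} and t > 0, where Δ is the Laplacian in x. -/
open Real MeasureTheory Filter Set

noncomputable section

theorem aux_summable_s6 (a : ℕ → ℝ) (C K : ℝ) (ha : ∀ n, |a n| ≤ C * (K ^ n / (n.factorial : ℝ))) (s : ℝ) :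
    Summable (fun n => a n * s ^ n) := by
  refine Summable.of_norm_bounded (g := fun n => C * ((K * |s|) ^ n / (n.factorial : ℝ)))
    ((Real.summable_pow_div_factorial _).mul_left C) ?_
  intro n
  rw [norm_mul, norm_pow, Real.norm_eq_abs, Real.norm_eq_abs, mul_pow]
  calc |a n| * |s| ^ n ≤ C * (K ^ n / (n.factorial : ℝ)) * |s| ^ n := by
        gcongr; exact ha n
    _ = _ := by ring

theorem aux_bound_succ (a : ℕ → ℝ) (C K : ℝ) (ha : ∀ n, |a n| ≤ C * (K ^ n / (n.factorial : ℝ))) :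
    ∀ n : ℕ, |((n : ℝ) + 1) * a (n + 1)| ≤ (C * K) * (K ^ n / (n.factorial : ℝ)) := by
  intro n
  have h := ha (n + 1)
  have hn : (0 : ℝ) < (n : ℝ) + 1 := by positivity
  have hf : (0 : ℝ) < (n.factorial : ℝ) := by positivity
  rw [abs_mul, abs_of_pos hn]
  calc ((n : ℝ) + 1) * |a (n + 1)|
      ≤ ((n : ℝ) + 1) * (C * (K ^ (n + 1) / ((n + 1).factorial : ℝ))) := by gcongr
    _ = _ := by
      rw [Nat.factorial_succ]; push_cast; field_simp; ring

theorem aux_deriv (a : ℕ → ℝ) (C K : ℝ) (ha : ∀ n, |a n| ≤ C * (K ^ n / (n.factorial : ℝ))) (s : ℝ) :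
    HasDerivAt (fun s => ∑' n, a n * s ^ n)
      (∑' n : ℕ, (((n : ℝ) + 1) * a (n + 1)) * s ^ n) s := by
  have hb := aux_bound_succ a C K ha
  set R := |s| + 1 with hR
  have hRpos : 0 < R := by positivity
  have hu : Summable (fun n : ℕ => |(n : ℝ) * a n| * R ^ (n - 1)) := by
    rw [← summable_nat_add_iff 1]
    have := (aux_summable_s6 _ _ _ hb R).abs
    refine this.congr fun n => ?_
    rw [abs_mul, abs_of_pos (pow_pos hRpos n)]
    simp
  have h := hasDerivAt_tsum_of_isPreconnected (g := fun n s => a n * s ^ n)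
    (g' := fun n s => a n * ((n : ℝ) * s ^ (n - 1))) (t := Metric.ball 0 R) (y₀ := 0) (y := s)
    hu Metric.isOpen_ball (convex_ball (0 : ℝ) R).isPreconnected
    (fun n y _ => (hasDerivAt_pow n y).const_mul (a n))
    (fun n y hy => by
      have hy' : |y| ≤ R := by
        have := hy
        rw [Metric.mem_ball, dist_zero_right, Real.norm_eq_abs] at this
        exact this.le
      rw [show a n * ((n : ℝ) * y ^ (n - 1)) = ((n : ℝ) * a n) * y ^ (n - 1) by ring,
        norm_mul, norm_pow, Real.norm_eq_abs, Real.norm_eq_abs]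
      gcongr)
    (Metric.mem_ball_self hRpos) (aux_summable_s6 a C K ha 0)
    (by rw [Metric.mem_ball, dist_zero_right, Real.norm_eq_abs, hR]; linarith)
  have hs : Summable (fun n : ℕ => a n * ((n : ℝ) * s ^ (n - 1))) := by
    rw [← summable_nat_add_iff 1]
    refine (aux_summable_s6 _ _ _ hb s).congr fun n => ?_
    simp; ring
  have hE : ∑' n : ℕ, a n * ((n : ℝ) * s ^ (n - 1))
      = ∑' n : ℕ, (((n : ℝ) + 1) * a (n + 1)) * s ^ n := by
    rw [hs.tsum_eq_zero_add]
    simp only [Nat.cast_zero, zero_mul, mul_zero, zero_add]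
    refine tsum_congr fun n => ?_
    simp only [Nat.add_sub_cancel]
    push_cast
    ring
  rw [hE] at h
  exact h

/-- Kummer coefficients. -/
def kc (b c : ℝ) (n : ℕ) : ℝ :=
  ((∏ k ∈ Finset.range n, (b + (k : ℝ))) / (∏ k ∈ Finset.range n, (c + (k : ℝ))))
      / (n.factorial : ℝ)

theorem kc_succ (b c : ℝ) (hc : 0 < c) (n : ℕ) :
    ((n : ℝ) + 1) * (c + n) * kc b c (n + 1) = (b + n) * kc b c n := by
  unfold kc
  have h0 : (∏ k ∈ Finset.range n, (c + (k : ℝ))) ≠ 0 :=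
    Finset.prod_ne_zero_iff.2 fun k _ => by positivity
  have h1 : c + (n : ℝ) ≠ 0 := by positivity
  have h2 : (n.factorial : ℝ) ≠ 0 := by positivity
  rw [Finset.prod_range_succ, Finset.prod_range_succ, Nat.factorial_succ]
  push_cast
  field_simp

theorem kc_bound (b c : ℝ) (hc : 0 < c) (n : ℕ) :
    |kc b c n| ≤ 1 * ((|b| / c + 1) ^ n / (n.factorial : ℝ)) := by
  have hf : (0 : ℝ) < (n.factorial : ℝ) := by positivity
  unfold kc
  rw [abs_div, abs_of_pos hf, one_mul, ← Finset.prod_div_distrib, Finset.abs_prod]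
  gcongr
  calc ∏ i ∈ Finset.range n, |(b + (i : ℝ)) / (c + (i : ℝ))|
      ≤ ∏ i ∈ Finset.range n, (|b| / c + 1) := by
        refine Finset.prod_le_prod (fun _ _ => abs_nonneg _) fun i _ => ?_
        have hi : (0 : ℝ) < c + i := by positivity
        rw [abs_div, abs_of_pos hi, div_le_iff₀ hi]
        have h1 : |b + (i : ℝ)| ≤ |b| + i := by
          have := abs_add_le b (i : ℝ)
          rwa [Nat.abs_cast] at this
        have h2 : (|b| / c + 1) * (c + i) = |b| + i + (c + |b| / c * i) := by
          field_simp; ring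
        have h3 : 0 ≤ c + |b| / c * i := by positivity
        linarith
    _ = _ := by simp

theorem kummer_ode (b c : ℝ) (hc : 0 < c) : ∃ M1 M2 : ℝ → ℝ,
    (∀ s, HasDerivAt (kummerM b c) (M1 s) s) ∧ (∀ s, HasDerivAt M1 (M2 s) s) ∧
    ∀ s, s * M2 s + (c - s) * M1 s - b * kummerM b c s = 0 := by
  have hM : kummerM b c = fun s => ∑' n, kc b c n * s ^ n := by
    funext s
    unfold kummerM kc
    exact tsum_congr fun n => by ring
  have h0 := kc_bound b c hc
  have h1 := aux_bound_succ _ _ _ h0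
  have h2 := aux_bound_succ _ _ _ h1
  refine ⟨_, _, ?_, fun s => aux_deriv _ _ _ h1 s, ?_⟩
  · intro s
    rw [hM]
    exact aux_deriv _ _ _ h0 s
  intro s
  rw [hM]
  have s0 := aux_summable_s6 _ _ _ h0 s
  have s1 := aux_summable_s6 _ _ _ h1 s
  have s2 := aux_summable_s6 _ _ _ h2 s
  -- s * M1 and s * M2 as series
  have shift : ∀ w : ℕ → ℝ, Summable (fun n : ℕ => (((n : ℝ) + 1) * w (n + 1)) * s ^ n) →
      HasSum (fun n : ℕ => (n : ℝ) * w n * s ^ n)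
      (s * ∑' n : ℕ, (((n : ℝ) + 1) * w (n + 1)) * s ^ n) := by
    intro w hw
    rw [← hasSum_nat_add_iff' 1]
    simp only [Finset.sum_range_one, Nat.cast_zero, zero_mul, sub_zero]
    have := hw.hasSum.mul_left s
    have hw' : (fun n : ℕ => ((n + 1 : ℕ) : ℝ) * w (n + 1) * s ^ (n + 1))
        = fun n : ℕ => s * (((n : ℝ) + 1) * w (n + 1) * s ^ n) := by
      funext n; push_cast; ring
    rw [hw']
    exact this
  have e1 := shift _ s1
  have e2 := shift (fun n : ℕ => ((n : ℝ) + 1) * kc b c (n + 1)) s2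
  have e := ((e2.add (s1.hasSum.mul_left c)).sub e1).sub (s0.hasSum.mul_left b)
  have hz : ∀ n : ℕ, (n : ℝ) * (((n : ℝ) + 1) * kc b c (n + 1)) * s ^ n
      + c * (((n : ℝ) + 1) * kc b c (n + 1) * s ^ n) - (n : ℝ) * kc b c n * s ^ n - b * (kc b c n * s ^ n) = 0 := by
    intro n
    linear_combination s ^ n * kc_succ b c hc n
  have e0 := e.unique (by rw [funext hz]; exact hasSum_zero)
  beta_reduce
  linear_combination e0

theorem phi_ode (N : ℕ) (hN : 2 ≤ N) (α : ℝ) (hα1 : α < 1) (β : ℝ) : ∃ f1 f2 : ℝ → ℝ,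
    (∀ s, HasDerivAt (phiK N α β) (f1 s) s) ∧ (∀ s, HasDerivAt f1 (f2 s) s) ∧
    ∀ s, s * f2 s + (((N : ℝ) - α) / (2 - α) + s) * f1 s + β * phiK N α β s = 0 := by
  have hN' : (2 : ℝ) ≤ N := by exact_mod_cast hN
  have hc : 0 < ((N : ℝ) - α) / (2 - α) := div_pos (by linarith) (by linarith)
  obtain ⟨M1, M2, h1, h2, h3⟩ := kummer_ode (((N : ℝ) - α) / (2 - α) - β) _ hc
  have he : ∀ s : ℝ, HasDerivAt (fun s : ℝ => Real.exp (-s)) (-Real.exp (-s)) s := fun s => by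
    simpa using (hasDerivAt_neg s).exp
  unfold phiK
  set c := ((N : ℝ) - α) / (2 - α)
  set M := kummerM (c - β) c
  refine ⟨fun s => -Real.exp (-s) * M s + Real.exp (-s) * M1 s,
    fun s => (-(-Real.exp (-s)) * M s + -Real.exp (-s) * M1 s) +
      (-Real.exp (-s) * M1 s + Real.exp (-s) * M2 s), fun s => (he s).mul (h1 s),
      fun s => ((he s).neg.mul (h1 s)).add ((he s).mul (h2 s)), fun s => ?_⟩
  linear_combination Real.exp (-s) * h3 s

theorem laplacian_radial {N : ℕ} (g g1 : ℝ → ℝ) (g2 : ℝ) (x : E N) (hx : x ≠ 0)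
    (h1 : ∀ q, 0 < q → HasDerivAt g (g1 q) q) (h2 : HasDerivAt g1 g2 (‖x‖ ^ 2)) :
    laplacian (fun y : E N => g (‖y‖ ^ 2)) x = 2 * N * g1 (‖x‖ ^ 2) + 4 * ‖x‖ ^ 2 * g2 := by
  have hd : ∀ y : E N, y ≠ 0 → ∀ i, fderiv ℝ (fun y : E N => g (‖y‖ ^ 2)) y
      (EuclideanSpace.single i 1) = g1 (‖y‖ ^ 2) * (2 * y i) := by
    intro y hy i
    have hq : 0 < ‖y‖ ^ 2 := by positivity
    have := (h1 _ hq).comp_hasFDerivAt y (hasStrictFDerivAt_norm_sq y).hasFDerivAt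
    have e : fderiv ℝ (fun y : E N => g (‖y‖ ^ 2)) y = _ := this.fderiv
    rw [e]
    simp [EuclideanSpace.inner_single_right]
  unfold laplacian
  have key : ∀ i : Fin N, fderiv ℝ (fun y => fderiv ℝ (fun y : E N => g (‖y‖ ^ 2)) y
      (EuclideanSpace.single i 1)) x (EuclideanSpace.single i 1)
      = 2 * g1 (‖x‖ ^ 2) + 4 * g2 * (x i) ^ 2 := by
    intro i
    have hev : (fun y => fderiv ℝ (fun y : E N => g (‖y‖ ^ 2)) y (EuclideanSpace.single i 1))
        =ᶠ[nhds x] fun y => g1 (‖y‖ ^ 2) * (2 * y i) := by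
      filter_upwards [isOpen_ne.mem_nhds hx] with y hy using hd y hy i
    rw [hev.fderiv_eq]
    have a1 := h2.comp_hasFDerivAt x (hasStrictFDerivAt_norm_sq x).hasFDerivAt
    have a2 : HasFDerivAt (fun y : E N => 2 * y i)
        ((2 : ℝ) • (EuclideanSpace.proj i : E N →L[ℝ] ℝ)) x :=
      (EuclideanSpace.proj i : E N →L[ℝ] ℝ).hasFDerivAt.const_mul 2
    have e : fderiv ℝ (fun y : E N => g1 (‖y‖ ^ 2) * (2 * y i)) x = _ := (a1.mul a2).fderiv
    rw [e]
    simp [EuclideanSpace.inner_single_right]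
    ring
  simp only [key]
  rw [Finset.sum_add_distrib, ← Finset.mul_sum, ← Finset.mul_sum, ← EuclideanSpace.real_norm_sq_eq]
  simp
  ring

/-- Lemma 2.6 (i). For every `β ∈ ℝ`, `Φ_β` satisfies
`∂_t Φ_β(x,t) = |x|^α Δ Φ_β(x,t)` for all `x ∈ ℝ^N ∖ {0}` and `t > 0`. -/
theorem PhiK_solves_heat
    (N : ℕ) (hN : 2 ≤ N) (α : ℝ) (hα0 : 0 ≤ α) (hα1 : α < 1) (β : ℝ) :
    ∀ (x : E N), x ≠ 0 → ∀ t : ℝ, 0 < t →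
      deriv (PhiK N α β x) t = ‖x‖ ^ α * laplacian (fun y => PhiK N α β y t) x := by
  intro x hx t ht
  obtain ⟨f1, f2, h1, h2, h3⟩ := phi_ode N hN α hα1 β
  have hr : 0 < ‖x‖ := by positivity
  have hα : 0 < 2 - α := by linarith
  obtain ⟨p, hp⟩ : ∃ p, p = (2 - α) / 2 := ⟨_, rfl⟩
  obtain ⟨κ, hκ⟩ : ∃ κ, κ = 1 / ((2 - α) ^ 2 * t) := ⟨_, rfl⟩
  have hpow : ∀ y : E N, ‖y‖ ^ (2 - α) = (‖y‖ ^ 2) ^ p := by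
    intro y
    rw [← Real.rpow_natCast, ← Real.rpow_mul (norm_nonneg y), hp]
    congr 1; push_cast; ring
  have hfun : (fun y => PhiK N α β y t)
      = fun y : E N => (fun q : ℝ => t ^ (-β) * phiK N α β (κ * q ^ p)) (‖y‖ ^ 2) := by
    funext y
    unfold PhiK
    rw [hpow, hκ]
    congr 2; ring
  have hqpos : 0 < ‖x‖ ^ 2 := by positivity
  have hin : ∀ q : ℝ, 0 < q → HasDerivAt (fun q : ℝ => κ * q ^ p) (κ * (p * q ^ (p - 1))) q :=
    fun q hq => (Real.hasDerivAt_rpow_const (Or.inl hq.ne')).const_mul κ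
  have hin2 : ∀ q : ℝ, 0 < q → HasDerivAt (fun q : ℝ => κ * (p * q ^ (p - 1)))
      (κ * (p * ((p - 1) * q ^ (p - 1 - 1)))) q :=
    fun q hq => ((Real.hasDerivAt_rpow_const (Or.inl hq.ne')).const_mul p).const_mul κ
  rw [hfun, laplacian_radial (fun q : ℝ => t ^ (-β) * phiK N α β (κ * q ^ p))
    (fun q => t ^ (-β) * (f1 (κ * q ^ p) * (κ * (p * q ^ (p - 1))))) _ x hx
    (fun q hq => ((h1 _).comp q (hin q hq)).const_mul _)
    ((((h2 _).comp _ (hin _ hqpos)).mul (hin2 _ hqpos)).const_mul _)]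
  have hxa : ‖x‖ ^ α = (‖x‖ ^ 2) ^ (1 - p) := by
    rw [← Real.rpow_natCast, ← Real.rpow_mul (norm_nonneg x), hp]
    congr 1; push_cast; ring
  have hs : HasDerivAt (fun τ : ℝ => ‖x‖ ^ (2 - α) / ((2 - α) ^ 2 * τ))
      (-(κ * (‖x‖ ^ 2) ^ p) / t) t := by
    have := ((hasDerivAt_inv ht.ne').const_mul (‖x‖ ^ (2 - α) / (2 - α) ^ 2))
    have w1 : (fun τ : ℝ => ‖x‖ ^ (2 - α) / ((2 - α) ^ 2 * τ))
        = fun y => ‖x‖ ^ (2 - α) / (2 - α) ^ 2 * y⁻¹ := by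
      funext τ; rw [div_mul_eq_div_div, div_eq_mul_inv _ τ]
    have w2 : -(κ * (‖x‖ ^ 2) ^ p) / t = ‖x‖ ^ (2 - α) / (2 - α) ^ 2 * -(t ^ 2)⁻¹ := by
      rw [hpow, hκ]; field_simp
    rw [w1, w2]
    exact this
  have hst : ‖x‖ ^ (2 - α) / ((2 - α) ^ 2 * t) = κ * (‖x‖ ^ 2) ^ p := by
    rw [hpow, hκ]; ring
  have hL : HasDerivAt (PhiK N α β x) _ t :=
    (Real.hasDerivAt_rpow_const (p := -β) (Or.inl ht.ne')).mul ((h1 _).comp t hs)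
  rw [hL.deriv, hxa]
  simp only [Function.comp, hst]
  have ode := h3 (κ * (‖x‖ ^ 2) ^ p)
  generalize ‖x‖ ^ 2 = q at *
  rw [Real.rpow_sub hqpos 1 p, Real.rpow_sub hqpos (p - 1) 1, Real.rpow_sub hqpos p 1,
    Real.rpow_sub ht, Real.rpow_one, Real.rpow_one]
  have hP : 0 < q ^ p := Real.rpow_pos_of_pos hqpos p
  have hT : 0 < t ^ (-β) := Real.rpow_pos_of_pos ht _
  generalize q ^ p = P at *
  generalize t ^ (-β) = T at *
  generalize f1 (κ * P) = F1 at *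
  generalize f2 (κ * P) = F2 at *
  generalize phiK N α β (κ * P) = F0 at *
  subst hp
  subst hκ
  have hd : (2 - α) ≠ 0 := hα.ne'
  have hF0 : β * F0 = -(1 / ((2 - α) ^ 2 * t) * P * F2
      + (((N : ℝ) - α) / (2 - α) + 1 / ((2 - α) ^ 2 * t) * P) * F1) := by linarith
  have e1 : -β * (T / t) * F0 = -(T / t) * (β * F0) := by ring
  rw [e1, hF0]
  field_simp
  ring
end
end

section
/- Let N ≥ 2 and α ∈ [0,1). For every β ∈ ℝ, the identity ∂_t Φ_β(x,t) = −β Φ_{β+1}(x,t) holds for all x ∈ ℝ^N and t > 0. -/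
open Real MeasureTheory Filter Set

noncomputable section

def kco (b c : ℝ) (n : ℕ) : ℝ :=
  ((∏ k ∈ Finset.range n, (b + (k : ℝ))) / (∏ k ∈ Finset.range n, (c + (k : ℝ))))
    / (n.factorial : ℝ)

lemma kummerM_eq (b c s : ℝ) : kummerM b c s = ∑' n : ℕ, kco b c n * s ^ n := by
  unfold kummerM kco
  congr 1
  funext n
  ring

lemma kco_succ (b c : ℝ) (n : ℕ) :
    kco b c (n + 1) = kco b c n * ((b + n) / ((c + n) * (n + 1))) := by
  unfold kco
  rw [Finset.prod_range_succ, Finset.prod_range_succ, Nat.factorial_succ]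
  push_cast
  simp only [div_eq_mul_inv, mul_inv]
  ring

lemma kco_bound (b c : ℝ) (hc : 0 < c) (n : ℕ) :
    |kco b c (n + 1)| ≤ |kco b c n| * ((|b| / c + 1) / (n + 1)) := by
  rw [kco_succ, abs_mul]
  apply mul_le_mul_of_nonneg_left _ (abs_nonneg _)
  have hn : (0 : ℝ) ≤ n := Nat.cast_nonneg n
  have h1 : |b + n| ≤ (|b| / c + 1) * (c + n) := by
    have h2 : |b + n| ≤ |b| + n := by
      simpa [abs_of_nonneg hn] using abs_add_le b (n : ℝ)
    have h3 : (|b| / c + 1) * (c + n) = |b| + n + c + |b| / c * n := by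
      field_simp
      ring
    have h4 : 0 ≤ |b| / c * n := by positivity
    linarith
  rw [abs_div, abs_of_pos (show 0 < (c + n) * ((n : ℝ) + 1) by positivity),
    div_le_div_iff₀ (by positivity) (by positivity)]
  nlinarith [mul_le_mul_of_nonneg_right h1 (show (0 : ℝ) ≤ n + 1 by positivity)]

lemma kco_summable1 (b c : ℝ) (hc : 0 < c) (s : ℝ) :
    Summable (fun n : ℕ => (n : ℝ) * kco b c n * s ^ n) := by
  set C := |b| / c + 1
  have hC : 0 ≤ C := by positivity
  obtain ⟨m, hm⟩ := exists_nat_ge (4 * C * |s|)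
  apply summable_of_ratio_norm_eventually_le (r := 1 / 2) (by norm_num)
  filter_upwards [eventually_ge_atTop (max m 1)] with n hn
  have hn1 : (1 : ℝ) ≤ n := by exact_mod_cast (le_max_right m 1).trans hn
  have hnm : (m : ℝ) ≤ n := by exact_mod_cast (le_max_left m 1).trans hn
  simp only [norm_mul, norm_pow, Real.norm_eq_abs]
  rw [pow_succ, Nat.abs_cast, Nat.abs_cast]
  push_cast
  have hb := kco_bound b c hc n
  have h1 : ((n : ℝ) + 1) * |kco b c (n + 1)| ≤ |kco b c n| * C := by
    calc ((n : ℝ) + 1) * |kco b c (n + 1)|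
        ≤ (n + 1) * (|kco b c n| * (C / (n + 1))) := by gcongr
      _ = |kco b c n| * C := by field_simp
  calc ((n : ℝ) + 1) * |kco b c (n + 1)| * (|s| ^ n * |s|)
      ≤ |kco b c n| * C * (|s| ^ n * |s|) := by gcongr
    _ = (C * |s|) * (|kco b c n| * |s| ^ n) := by ring
    _ ≤ (1 / 2 * n) * (|kco b c n| * |s| ^ n) := by
        have h2 : C * |s| ≤ 1 / 2 * n := by linarith
        exact mul_le_mul_of_nonneg_right h2 (by positivity)
    _ = 1 / 2 * (n * |kco b c n| * |s| ^ n) := by ring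

lemma kco_summable0 (b c : ℝ) (hc : 0 < c) (s : ℝ) :
    Summable (fun n : ℕ => kco b c n * s ^ n) := by
  refine Summable.of_norm_bounded_eventually_nat (kco_summable1 b c hc s).norm ?_
  filter_upwards [eventually_ge_atTop 1] with n hn
  have hn1 : (1 : ℝ) ≤ n := by exact_mod_cast hn
  rw [mul_assoc, norm_mul (n : ℝ), Real.norm_of_nonneg (Nat.cast_nonneg n)]
  exact le_mul_of_one_le_left (norm_nonneg _) hn1

lemma kummerM_hasDerivAt (b c : ℝ) (hc : 0 < c) (s : ℝ) :
    HasDerivAt (kummerM b c) (∑' n : ℕ, kco b c n * (n * s ^ (n - 1))) s := by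
  have hfun : kummerM b c = fun s => ∑' n : ℕ, kco b c n * s ^ n := by
    funext s
    exact kummerM_eq b c s
  rw [hfun]
  set R := |s| + 1
  have hR : 0 < R := by positivity
  have hu : Summable (fun n : ℕ => |kco b c n| * (n * R ^ (n - 1))) := by
    have := ((kco_summable1 b c hc R).norm).mul_left R⁻¹
    refine this.congr fun n => ?_
    simp only [norm_mul, norm_pow, Real.norm_eq_abs, abs_of_pos hR, Nat.abs_cast]
    rcases n with _ | n
    · simp
    · simp only [Nat.add_sub_cancel, pow_succ]
      field_simp
  refine hasDerivAt_tsum_of_isPreconnected (g := fun n s => kco b c n * s ^ n)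
    (g' := fun n s => kco b c n * (n * s ^ (n - 1))) (t := Metric.ball (0 : ℝ) R) (y₀ := 0) hu
    Metric.isOpen_ball (convex_ball _ _).isPreconnected ?_ ?_ ?_ ?_ ?_
  · intro n y _
    exact (hasDerivAt_pow n y).const_mul _
  · intro n y hy
    have hy' : |y| ≤ R := by
      have := hy
      rw [Metric.mem_ball, dist_zero_right, Real.norm_eq_abs] at this
      exact this.le
    simp only [norm_mul, norm_pow, Real.norm_eq_abs, Nat.abs_cast]
    gcongr
  · simpa using hR
  · exact kco_summable0 b c hc 0
  · simp only [Metric.mem_ball, dist_zero_right, Real.norm_eq_abs]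
    exact lt_add_one _

lemma kco_shift (b c : ℝ) (hc : 0 < c) (n : ℕ) :
    (c - b + (n + 1)) * kco b c (n + 1) - kco b c n = (c - b) * kco (b - 1) c (n + 1) := by
  have hp : (∏ k ∈ Finset.range (n + 1), (b - 1 + (k : ℝ)))
      = (b - 1) * ∏ k ∈ Finset.range n, (b + (k : ℝ)) := by
    rw [Finset.prod_range_succ']
    push_cast
    rw [mul_comm]
    congr 1
    · ring
    · apply Finset.prod_congr rfl
      intros
      ring
  have hP : (∏ k ∈ Finset.range n, (c + (k : ℝ))) ≠ 0 :=
    (Finset.prod_pos fun k _ => by positivity).ne'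
  have hf : (n.factorial : ℝ) ≠ 0 := by positivity
  have hcn : c + n ≠ 0 := by positivity
  have hn : (n : ℝ) + 1 ≠ 0 := by positivity
  unfold kco
  rw [hp, Finset.prod_range_succ, Finset.prod_range_succ, Nat.factorial_succ]
  push_cast
  field_simp
  ring

lemma kummer_rel (b c : ℝ) (hc : 0 < c) (s : ℝ) :
    (c - b) * kummerM b c s + s * (∑' n : ℕ, kco b c n * (n * s ^ (n - 1))) - s * kummerM b c s
      = (c - b) * kummerM (b - 1) c s := by
  have h1 : s * (∑' n : ℕ, kco b c n * (n * s ^ (n - 1))) = ∑' n : ℕ, n * kco b c n * s ^ n := by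
    rw [← tsum_mul_left]
    congr 1
    funext n
    rcases n with _ | n
    · simp
    · simp only [Nat.add_sub_cancel, pow_succ]
      ring
  rw [h1]
  simp only [kummerM_eq]
  have S0 := kco_summable0 b c hc s
  have S1 := kco_summable1 b c hc s
  have S2 := kco_summable0 (b - 1) c hc s
  have T0 := (summable_nat_add_iff 1).2 S0
  have T1 := (summable_nat_add_iff 1).2 S1
  rw [S2.tsum_eq_zero_add, S1.tsum_eq_zero_add]
  conv_lhs => enter [1, 1]; rw [S0.tsum_eq_zero_add]
  have key : (c - b) * ∑' n : ℕ, kco (b - 1) c (n + 1) * s ^ (n + 1)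
      = (c - b) * (∑' n : ℕ, kco b c (n + 1) * s ^ (n + 1))
        + (∑' n : ℕ, ((n + 1 : ℕ) : ℝ) * kco b c (n + 1) * s ^ (n + 1))
        - s * ∑' n : ℕ, kco b c n * s ^ n := by
    rw [← tsum_mul_left, ← tsum_mul_left, ← tsum_mul_left,
      ← (T0.mul_left (c - b)).tsum_add T1,
      ← ((T0.mul_left (c - b)).add T1).tsum_sub (S0.mul_left s)]
    congr 1
    funext n
    rw [← mul_assoc, ← kco_shift b c hc n]
    push_cast
    ring
  have z : ∀ b, kco b c 0 = 1 := fun b => by simp [kco]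
  rw [mul_add, mul_add, key, z, z]
  simp
  ring

/-- Lemma 2.6 (ii). For every `β ∈ ℝ`,
`∂_t Φ_β(x,t) = −β Φ_{β+1}(x,t)` for all `x ∈ ℝ^N` and `t > 0`. -/
theorem PhiK_time_derivative
    (N : ℕ) (hN : 2 ≤ N) (α : ℝ) (hα0 : 0 ≤ α) (hα1 : α < 1) (β : ℝ) :
    ∀ (x : E N) (t : ℝ), 0 < t →
      deriv (PhiK N α β x) t = -β * PhiK N α (β + 1) x t := by
  intro x t ht
  have hN' : (2 : ℝ) ≤ N := by exact_mod_cast hN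
  have hα2 : 0 < 2 - α := by linarith
  have hc : 0 < ((N : ℝ) - α) / (2 - α) := div_pos (by linarith) hα2
  unfold PhiK phiK
  generalize ((N : ℝ) - α) / (2 - α) = c at *
  generalize ‖x‖ ^ (2 - α) = K
  have hD : (2 - α) ^ 2 ≠ 0 := by positivity
  generalize (2 - α) ^ 2 = D at *
  have hs : HasDerivAt (fun t => K / (D * t)) (-(K / (D * t)) / t) t := by
    have h := (((hasDerivAt_id t).const_mul D).inv (by simp [hD, ht.ne'])).const_mul K
    have h' : HasDerivAt (fun t => K / (D * t)) (K * (-(D * 1) / (D * t) ^ 2)) t := h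
    have e : -(K / (D * t)) / t = K * (-(D * 1) / (D * t) ^ 2) := by
      field_simp
    rw [e]
    exact h'
  have hrel := kummer_rel (c - β) c hc (K / (D * t))
  have hM := (kummerM_hasDerivAt (c - β) c hc (K / (D * t))).comp t hs
  have hE := hs.neg.exp
  have hT := Real.hasDerivAt_rpow_const (x := t) (p := -β) (Or.inl ht.ne')
  have h := (hT.mul (hE.mul hM)).deriv
  refine Eq.trans h ?_
  simp only [Function.comp, Pi.mul_apply, Pi.neg_apply]
  have e1 : c - (β + 1) = c - β - 1 := by ring
  have e2 : -(β + 1) = -β - 1 := by ring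
  have e3 : t ^ (-β) = t ^ (-β - 1) * t := by
    rw [Real.rpow_sub_one ht.ne']
    field_simp
  rw [e1, e2, e3]
  generalize K / (D * t) = s at *
  generalize (∑' n : ℕ, kco (c - β) c n * (n * s ^ (n - 1))) = M' at *
  have e4 : t * (-s / t) = -s := by field_simp
  have e5 : t * (-(-s / t)) = s := by field_simp
  linear_combination (-t ^ (-β - 1) * Real.exp (-s)) * hrel
    + t ^ (-β - 1) * Real.exp (-s) * (M' - kummerM (c - β) c s) * e4
end
end

section
/- Let N ≥ 2 and α ∈ [0,1). For every β ∈ ℝ there exists C_β > 0 such that |Φ_β(x,t)| ≤ C_β Ψ^{−β}(x,t) for all x ∈ ℝ^N and t > 0; moreover, if β < (N−α)/(2−α), then there exists c_β > 0 such that Φ_β(x,t) ≥ c_β Ψ^{−β}(x,t) for all x ∈ ℝ^N and t > 0. In particular, for β < (N−α)/(2−α) one has c_β^{−1} Ψ^{β}(x,t) ≤ Φ_β(x,t)^{−1} ≤ C_β^{−1} Ψ^{β}(x,t). -/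
open Real MeasureTheory Filter Set

noncomputable section

lemma aux_fact (n m : ℕ) : (n + m).factorial ≤ n.factorial * (n + 1) ^ m * m.factorial := by
  induction m with
  | zero => simp
  | succ m ih =>
    rw [← add_assoc, Nat.factorial_succ, Nat.factorial_succ, pow_succ]
    calc (n + m + 1) * (n + m).factorial
        ≤ ((n + 1) * (m + 1)) * (n.factorial * (n + 1) ^ m * m.factorial) := by
          apply Nat.mul_le_mul _ ih
          nlinarith [Nat.zero_le (n * m)]
      _ = _ := by ring

lemma aux_hasSum (s : ℝ) : HasSum (fun n : ℕ => s ^ n / (n.factorial : ℝ)) (Real.exp s) := by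
  rw [Real.exp_eq_exp_ℝ]
  exact NormedSpace.expSeries_div_hasSum_exp s

lemma aux_rpow (u γ : ℝ) (m : ℕ) (hm : |γ| ≤ m) (hu : 0 < u) : u ^ γ ≤ u ^ m + (u⁻¹) ^ m := by
  have h := abs_le.1 hm
  rcases le_total 1 u with h1 | h1
  · have : u ^ γ ≤ u ^ (m : ℝ) := Real.rpow_le_rpow_of_exponent_le h1 h.2
    rw [Real.rpow_natCast] at this
    have : 0 ≤ (u⁻¹) ^ m := by positivity
    linarith
  · have : u ^ γ ≤ u ^ (-(m : ℝ)) := Real.rpow_le_rpow_of_exponent_ge hu h1 h.1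
    rw [Real.rpow_neg hu.le, Real.rpow_natCast, ← inv_pow] at this
    have : 0 ≤ u ^ m := by positivity
    linarith

lemma aux_shift_s8 (s : ℝ) (hs : 0 ≤ s) (m : ℕ) :
    Summable (fun n : ℕ => s ^ (n + m) / ((n + m).factorial : ℝ)) ∧
      ∑' n : ℕ, s ^ (n + m) / ((n + m).factorial : ℝ) ≤ Real.exp s := by
  have h := aux_hasSum s
  have h2 : Summable (fun n : ℕ => s ^ (n + m) / ((n + m).factorial : ℝ)) :=
    (summable_nat_add_iff m).2 h.summable
  refine ⟨h2, ?_⟩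
  have h3 := h.summable.sum_add_tsum_nat_add m
  rw [h.tsum_eq] at h3
  have : 0 ≤ ∑ i ∈ Finset.range m, s ^ i / (i.factorial : ℝ) :=
    Finset.sum_nonneg fun i _ => by positivity
  linarith

lemma aux_U (γ : ℝ) : ∃ C : ℝ, 0 < C ∧ ∀ s : ℝ, 0 ≤ s →
    Summable (fun n : ℕ => (((n : ℝ) + 1) / (1 + s)) ^ γ * (s ^ n / (n.factorial : ℝ))) ∧
    ∑' n : ℕ, (((n : ℝ) + 1) / (1 + s)) ^ γ * (s ^ n / (n.factorial : ℝ)) ≤ C * Real.exp s := by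
  obtain ⟨m, hm⟩ := exists_nat_ge |γ|
  refine ⟨m.factorial * Real.exp 1 * Real.exp 2 + 2 ^ m * (1 + m.factorial), by positivity, ?_⟩
  intro s hs
  set θ : ℝ := 1 / (1 + s) with hθ
  have hθ0 : 0 < θ := by positivity
  have hθ1 : θ ≤ 1 := by rw [hθ, div_le_one (by positivity)]; linarith
  have hsθ : s * θ ≤ 1 := by
    rw [hθ, mul_one_div, div_le_one (by positivity)]; linarith
  have hexp : Real.exp θ ≤ 1 + 2 * θ := by
    have := Real.abs_exp_sub_one_le (x := θ) (by rw [abs_of_pos hθ0]; exact hθ1)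
    rw [abs_of_pos hθ0] at this
    linarith [le_abs_self (Real.exp θ - 1)]
  have hS1 := aux_hasSum (s * Real.exp θ)
  have hS2 := aux_hasSum s
  obtain ⟨hS3, hS3'⟩ := aux_shift_s8 s hs m
  have hG := ((hS1.mul_left (m.factorial * Real.exp θ)).add
    ((hS2.add (hS3.hasSum.mul_left (m.factorial : ℝ))).mul_left ((2:ℝ) ^ m)))
  have hpt : ∀ n : ℕ, (((n : ℝ) + 1) / (1 + s)) ^ γ * (s ^ n / (n.factorial : ℝ)) ≤
      m.factorial * Real.exp θ * ((s * Real.exp θ) ^ n / (n.factorial : ℝ)) +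
      2 ^ m * (s ^ n / (n.factorial : ℝ) +
        m.factorial * (s ^ (n + m) / ((n + m).factorial : ℝ))) := by
    intro n
    set u : ℝ := ((n : ℝ) + 1) / (1 + s) with hu
    have hu0 : 0 < u := by positivity
    have h1 := aux_rpow u γ m hm hu0
    have h2 : u ^ m ≤ m.factorial * Real.exp u := by
      have := Real.pow_div_factorial_le_exp u hu0.le m
      rw [div_le_iff₀ (by positivity)] at this
      linarith
    have h3 : Real.exp u = Real.exp θ * Real.exp θ ^ n := by
      rw [← Real.exp_nat_mul, ← Real.exp_add]; congr 1; rw [hu, hθ]; ring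
    have h4 : (1 + s) ^ m ≤ 2 ^ m * (1 + s ^ m) := by
      rcases le_total 1 s with h | h
      · calc (1 + s) ^ m ≤ (2 * s) ^ m := by gcongr; linarith
          _ = 2 ^ m * s ^ m := mul_pow _ _ _
          _ ≤ _ := by gcongr; linarith
      · calc (1 + s) ^ m ≤ 2 ^ m := by gcongr; linarith
          _ ≤ _ := by
            have : (0:ℝ) ≤ 2 ^ m * s ^ m := by positivity
            linarith
    have hp : (0:ℝ) ≤ s ^ n / (n.factorial : ℝ) := by positivity
    have h5 : (u⁻¹) ^ m * (s ^ n / (n.factorial : ℝ)) ≤ 2 ^ m * (s ^ n / (n.factorial : ℝ) +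
        m.factorial * (s ^ (n + m) / ((n + m).factorial : ℝ))) := by
      have e1 : (u⁻¹) ^ m = (1 + s) ^ m * (1 / ((n : ℝ) + 1) ^ m) := by
        rw [hu, inv_div, div_pow]; ring
      have e2 : 1 / ((n : ℝ) + 1) ^ m ≤ 1 := by
        rw [div_le_one (by positivity)]
        exact one_le_pow₀ (by linarith [(Nat.cast_nonneg n : (0:ℝ) ≤ n)])
      have e3 : 1 / ((n : ℝ) + 1) ^ m * (s ^ m * (s ^ n / (n.factorial : ℝ))) ≤
          m.factorial * (s ^ (n + m) / ((n + m).factorial : ℝ)) := by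
        have hf : ((n + m).factorial : ℝ) ≤ n.factorial * ((n:ℝ) + 1) ^ m * m.factorial := by
          exact_mod_cast aux_fact n m
        have e4 : 1 / ((n : ℝ) + 1) ^ m * (s ^ m * (s ^ n / (n.factorial : ℝ))) =
          s ^ (n + m) / (n.factorial * ((n:ℝ) + 1) ^ m) := by
          rw [pow_add]; field_simp
        rw [e4, ← mul_div_assoc, div_le_div_iff₀ (by positivity) (by positivity)]
        have := mul_le_mul_of_nonneg_left hf (show 0 ≤ s ^ (n + m) by positivity)
        linarith
      rw [e1]
      calc (1 + s) ^ m * (1 / ((n : ℝ) + 1) ^ m) * (s ^ n / (n.factorial : ℝ))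
          ≤ (2 ^ m * (1 + s ^ m)) * (1 / ((n : ℝ) + 1) ^ m) * (s ^ n / (n.factorial : ℝ)) := by
            gcongr
        _ = 2 ^ m * (1 / ((n : ℝ) + 1) ^ m * (s ^ n / (n.factorial : ℝ)) +
            1 / ((n : ℝ) + 1) ^ m * (s ^ m * (s ^ n / (n.factorial : ℝ)))) := by ring
        _ ≤ _ := by
          gcongr 2 ^ m * (?_ + ?_)
          · exact mul_le_of_le_one_left hp e2
    have h6 : u ^ m * (s ^ n / (n.factorial : ℝ)) ≤
        m.factorial * Real.exp θ * ((s * Real.exp θ) ^ n / (n.factorial : ℝ)) := by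
      calc _ ≤ (m.factorial * Real.exp u) * (s ^ n / (n.factorial : ℝ)) := by gcongr
        _ = _ := by rw [h3, mul_pow]; ring
    have h7 := mul_le_mul_of_nonneg_right h1 hp
    linarith
  have hsum : Summable (fun n : ℕ =>
      (((n : ℝ) + 1) / (1 + s)) ^ γ * (s ^ n / (n.factorial : ℝ))) :=
    Summable.of_nonneg_of_le (fun n => by positivity) hpt hG.summable
  refine ⟨hsum, ?_⟩
  have h1 := hsum.tsum_le_tsum hpt hG.summable
  rw [hG.tsum_eq] at h1
  refine h1.trans ?_
  have k1 : Real.exp (s * Real.exp θ) ≤ Real.exp 2 * Real.exp s := by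
    rw [← Real.exp_add]
    apply Real.exp_le_exp.2
    nlinarith [mul_le_mul_of_nonneg_left hexp hs]
  have k2 : Real.exp θ ≤ Real.exp 1 := Real.exp_le_exp.2 hθ1
  calc _ ≤ m.factorial * Real.exp 1 * (Real.exp 2 * Real.exp s) +
        2 ^ m * (Real.exp s + m.factorial * Real.exp s) := by gcongr
    _ = _ := by ring

lemma aux_L (γ : ℝ) : ∃ c : ℝ, 0 < c ∧ ∀ s : ℝ, 0 ≤ s →
    c * Real.exp s ≤
      ∑' n : ℕ, (((n : ℝ) + 1) / (1 + s)) ^ γ * (s ^ n / (n.factorial : ℝ)) := by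
  obtain ⟨C, hC, h⟩ := aux_U (-γ)
  obtain ⟨C', hC', h'⟩ := aux_U γ
  refine ⟨C⁻¹, by positivity, fun s hs => ?_⟩
  obtain ⟨hs1, hs2⟩ := h s hs
  obtain ⟨hs1', -⟩ := h' s hs
  have hE := aux_hasSum s
  have hG := (hE.mul_left (2 * C⁻¹)).sub (hs1.hasSum.mul_left (C⁻¹ ^ 2))
  have hle := hG.summable.tsum_le_tsum (g := fun n : ℕ =>
    (((n : ℝ) + 1) / (1 + s)) ^ γ * (s ^ n / (n.factorial : ℝ))) (fun n => by
      have hu0 : 0 < ((n : ℝ) + 1) / (1 + s) := by positivity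
      simp only [Real.rpow_neg hu0.le]
      have hv : 0 < (((n : ℝ) + 1) / (1 + s)) ^ γ := by positivity
      set v := (((n : ℝ) + 1) / (1 + s)) ^ γ
      have hp : (0:ℝ) ≤ s ^ n / (n.factorial : ℝ) := by positivity
      have key : 2 * C⁻¹ - C⁻¹ ^ 2 * v⁻¹ ≤ v := by
        have e : v - (2 * C⁻¹ - C⁻¹ ^ 2 * v⁻¹) = (v - C⁻¹) ^ 2 * v⁻¹ := by
          field_simp
          ring
        have : 0 ≤ (v - C⁻¹) ^ 2 * v⁻¹ := by positivity
        linarith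
      have := mul_le_mul_of_nonneg_right key hp
      linarith) hs1'
  rw [hG.tsum_eq] at hle
  refine le_trans ?_ hle
  have := mul_le_mul_of_nonneg_left hs2 (show 0 ≤ C⁻¹ ^ 2 by positivity)
  have e : C⁻¹ ^ 2 * (C * Real.exp s) = C⁻¹ * Real.exp s := by field_simp
  linarith

lemma aux_lim (b c : ℝ) (hc : 0 < c) (hb : ∀ m : ℕ, b ≠ -m) :
    Tendsto (fun n : ℕ => ((∏ k ∈ Finset.range (n + 1), (b + (k : ℝ))) /
      (∏ k ∈ Finset.range (n + 1), (c + (k : ℝ)))) * ((n : ℝ) + 2) ^ (c - b)) atTop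
      (nhds (Real.Gamma c / Real.Gamma b)) := by
  have h1 := (Real.GammaSeq_tendsto_Gamma c).div (Real.GammaSeq_tendsto_Gamma b)
    (Real.Gamma_ne_zero hb)
  have h2 : Tendsto (fun n : ℕ => (((n : ℝ) + 2) / n) ^ (c - b)) atTop (nhds 1) := by
    have h3 : Tendsto (fun n : ℕ => 1 + 2 / (n : ℝ)) atTop (nhds (1 + 0)) :=
      tendsto_const_nhds.add (tendsto_const_div_atTop_nhds_zero_nat 2)
    have h4 := h3.rpow_const (p := c - b) (Or.inl (by norm_num))
    simp only [add_zero, Real.one_rpow] at h4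
    refine h4.congr' ?_
    filter_upwards [eventually_gt_atTop 0] with n hn
    have : (n : ℝ) ≠ 0 := by positivity
    congr 1
    field_simp
  have h5 := h1.mul h2
  rw [mul_one] at h5
  refine h5.congr' ?_
  filter_upwards [eventually_gt_atTop 0] with n hn
  have hn' : (0:ℝ) < n := by positivity
  have pb : (∏ k ∈ Finset.range (n + 1), (b + (k : ℝ))) ≠ 0 :=
    Finset.prod_ne_zero_iff.2 fun k _ h => hb k (by linarith)
  have pc : (∏ k ∈ Finset.range (n + 1), (c + (k : ℝ))) ≠ 0 :=
    Finset.prod_ne_zero_iff.2 fun k _ => by positivity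
  simp only [Pi.div_apply, Real.GammaSeq]
  rw [Real.div_rpow (by positivity) hn'.le, Real.rpow_sub hn']
  have q1 : (n : ℝ) ^ b ≠ 0 := by positivity
  have q2 : (n : ℝ) ^ c ≠ 0 := by positivity
  field_simp

lemma aux_coef (b c : ℝ) (hc : 0 < c) : ∃ K : ℝ, 0 < K ∧ ∀ n : ℕ,
    |(∏ k ∈ Finset.range n, (b + (k : ℝ))) / (∏ k ∈ Finset.range n, (c + (k : ℝ)))| ≤
      K * ((n : ℝ) + 1) ^ (b - c) := by
  have hl : ∃ L : ℝ, Tendsto (fun n : ℕ => ((∏ k ∈ Finset.range (n + 1), (b + (k : ℝ))) /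
      (∏ k ∈ Finset.range (n + 1), (c + (k : ℝ)))) * ((n : ℝ) + 2) ^ (c - b)) atTop
      (nhds L) := by
    by_cases hb : ∀ m : ℕ, b ≠ -m
    · exact ⟨_, aux_lim b c hc hb⟩
    · push Not at hb
      obtain ⟨m, hm⟩ := hb
      refine ⟨0, tendsto_const_nhds.congr' ?_⟩
      filter_upwards [eventually_ge_atTop m] with n hn
      rw [Finset.prod_eq_zero (i := m) (Finset.mem_range.2 (by omega)) (by rw [hm]; ring)]
      simp
  obtain ⟨L, hL⟩ := hl
  obtain ⟨K, hK⟩ := hL.abs.bddAbove_range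
  refine ⟨max K 1, by positivity, fun n => ?_⟩
  cases n with
  | zero => simp
  | succ n =>
    have := hK ⟨n, rfl⟩
    simp only at this
    have hp : (0:ℝ) < (n : ℝ) + 2 := by positivity
    rw [abs_mul, abs_of_pos (Real.rpow_pos_of_pos hp _), ← neg_sub b c, Real.rpow_neg hp.le,
      ← div_eq_mul_inv, div_le_iff₀ (by positivity)] at this
    have e : (((n + 1 : ℕ) : ℝ) + 1) = (n : ℝ) + 2 := by push_cast; ring
    rw [e]
    refine this.trans ?_
    gcongr
    exact le_max_left _ _

lemma aux_coef_low (b c : ℝ) (hc : 0 < c) (hb : 0 < b) : ∃ K : ℝ, 0 < K ∧ ∀ n : ℕ,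
    K * ((n : ℝ) + 1) ^ (b - c) ≤
    (∏ k ∈ Finset.range n, (b + (k : ℝ))) / (∏ k ∈ Finset.range n, (c + (k : ℝ))) := by
  obtain ⟨K, hK, h⟩ := aux_coef c b hb
  refine ⟨K⁻¹, by positivity, fun n => ?_⟩
  have h1 := (le_abs_self _).trans (h n)
  have pb : 0 < (∏ k ∈ Finset.range n, (b + (k : ℝ))) :=
    Finset.prod_pos fun k _ => by positivity
  have pc : 0 < (∏ k ∈ Finset.range n, (c + (k : ℝ))) :=
    Finset.prod_pos fun k _ => by positivity
  have h2 := inv_anti₀ (by positivity) h1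
  rw [inv_div, mul_inv, ← Real.rpow_neg (by positivity), neg_sub] at h2
  exact h2

lemma aux_term (γ s : ℝ) (hs : 0 ≤ s) (n : ℕ) :
    ((n : ℝ) + 1) ^ γ = (1 + s) ^ γ * (((n : ℝ) + 1) / (1 + s)) ^ γ := by
  rw [← Real.mul_rpow (by positivity) (by positivity)]
  congr 1
  field_simp

lemma aux_kum (b c : ℝ) (hc : 0 < c) : ∃ C : ℝ, 0 < C ∧ ∀ s : ℝ, 0 ≤ s →
    Summable (fun n : ℕ =>
      ((∏ k ∈ Finset.range n, (b + (k : ℝ))) / (∏ k ∈ Finset.range n, (c + (k : ℝ))))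
      * s ^ n / (n.factorial : ℝ)) ∧
    |Real.exp (-s) * kummerM b c s| ≤ C * (1 + s) ^ (b - c) := by
  obtain ⟨K, hK, h⟩ := aux_coef b c hc
  obtain ⟨C, hC, hU⟩ := aux_U (b - c)
  refine ⟨K * C, by positivity, fun s hs => ?_⟩
  obtain ⟨u1, u2⟩ := hU s hs
  have hG := u1.hasSum.mul_left (K * (1 + s) ^ (b - c))
  have hle : ∀ n : ℕ, ‖((∏ k ∈ Finset.range n, (b + (k : ℝ))) /
      (∏ k ∈ Finset.range n, (c + (k : ℝ)))) * s ^ n / (n.factorial : ℝ)‖ ≤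
      K * (1 + s) ^ (b - c) *
        ((((n : ℝ) + 1) / (1 + s)) ^ (b - c) * (s ^ n / (n.factorial : ℝ))) := by
    intro n
    have hp : (0:ℝ) ≤ s ^ n / (n.factorial : ℝ) := by positivity
    rw [mul_div_assoc, norm_mul, Real.norm_of_nonneg hp, Real.norm_eq_abs]
    have := mul_le_mul_of_nonneg_right (h n) hp
    rw [aux_term _ s hs n] at this
    linarith
  refine ⟨Summable.of_norm_bounded hG.summable hle, ?_⟩
  have hn := tsum_of_norm_bounded hG hle
  rw [abs_mul, abs_of_pos (Real.exp_pos _)]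
  have hn' : |kummerM b c s| ≤ K * (1 + s) ^ (b - c) * (C * Real.exp s) := by
    refine le_trans hn ?_
    gcongr
  calc _ ≤ Real.exp (-s) * (K * (1 + s) ^ (b - c) * (C * Real.exp s)) := by gcongr
    _ = _ := by rw [Real.exp_neg]; field_simp

lemma aux_kum_low (b c : ℝ) (hc : 0 < c) (hb : 0 < b) : ∃ C : ℝ, 0 < C ∧ ∀ s : ℝ, 0 ≤ s →
    C * (1 + s) ^ (b - c) ≤ Real.exp (-s) * kummerM b c s := by
  obtain ⟨K, hK, h⟩ := aux_coef_low b c hc hb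
  obtain ⟨C, hC, hL⟩ := aux_L (b - c)
  obtain ⟨_, _, hU⟩ := aux_U (b - c)
  obtain ⟨_, _, hM⟩ := aux_kum b c hc
  refine ⟨K * C, by positivity, fun s hs => ?_⟩
  have hG := (hU s hs).1.hasSum.mul_left (K * (1 + s) ^ (b - c))
  have hle := hG.summable.tsum_le_tsum (g := fun n : ℕ =>
      ((∏ k ∈ Finset.range n, (b + (k : ℝ))) / (∏ k ∈ Finset.range n, (c + (k : ℝ))))
      * s ^ n / (n.factorial : ℝ)) (fun n => by
    have hp : (0:ℝ) ≤ s ^ n / (n.factorial : ℝ) := by positivity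
    have := mul_le_mul_of_nonneg_right (h n) hp
    rw [aux_term _ s hs n] at this
    simp only [mul_div_assoc] at this ⊢
    linarith) (hM s hs).1
  rw [hG.tsum_eq] at hle
  have hk : K * (1 + s) ^ (b - c) * (C * Real.exp s) ≤ kummerM b c s := by
    refine le_trans ?_ hle
    have := hL s hs
    gcongr
  calc _ = Real.exp (-s) * (K * (1 + s) ^ (b - c) * (C * Real.exp s)) := by
        rw [Real.exp_neg]; field_simp
    _ ≤ _ := by gcongr

lemma aux_Psi {N : ℕ} (α β : ℝ) (hα1 : α < 1) (x : E N) (t : ℝ) (ht : 0 < t) :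
    Psi α β x t = t ^ β * (1 + ‖x‖ ^ (2 - α) / ((2 - α) ^ 2 * t)) ^ β := by
  have h2 : 0 < 2 - α := by linarith
  rw [Psi, ← Real.mul_rpow ht.le (by positivity)]
  congr 1
  field_simp

/-- Lemma 2.6 (iii), (iv) and Remark 2.2. For every `β ∈ ℝ` there is
`C_β > 0` with `|Φ_β(x,t)| ≤ C_β Ψ^{−β}(x,t)`; moreover if `β < (N−α)/(2−α)` there is
`c_β > 0` with `Φ_β(x,t) ≥ c_β Ψ^{−β}(x,t)`, and in particular the weights `Φ_β^{−1}` and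
`Ψ^β` are equivalent: `C_β^{−1} Ψ^β ≤ Φ_β^{−1} ≤ c_β^{−1} Ψ^β`. -/
theorem PhiK_Psi_bounds
    (N : ℕ) (hN : 2 ≤ N) (α : ℝ) (hα0 : 0 ≤ α) (hα1 : α < 1) (β : ℝ) :
    ∃ C : ℝ, 0 < C ∧
      (∀ (x : E N) (t : ℝ), 0 < t → |PhiK N α β x t| ≤ C * Psi α (-β) x t) ∧
      (β < ((N : ℝ) - α) / (2 - α) →
        ∃ c : ℝ, 0 < c ∧
          (∀ (x : E N) (t : ℝ), 0 < t → c * Psi α (-β) x t ≤ PhiK N α β x t) ∧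
          (∀ (x : E N) (t : ℝ), 0 < t →
            C⁻¹ * Psi α β x t ≤ (PhiK N α β x t)⁻¹ ∧
            (PhiK N α β x t)⁻¹ ≤ c⁻¹ * Psi α β x t)) := by
  have h2 : 0 < 2 - α := by linarith
  have hN' : (2:ℝ) ≤ N := by exact_mod_cast hN
  have hc : 0 < ((N : ℝ) - α) / (2 - α) := div_pos (by linarith) h2
  obtain ⟨C, hC, hU⟩ := aux_kum (((N : ℝ) - α) / (2 - α) - β) (((N : ℝ) - α) / (2 - α)) hc
  simp only [sub_sub_cancel_left] at hU
  have hs : ∀ (x : E N) (t : ℝ), 0 < t → 0 ≤ ‖x‖ ^ (2 - α) / ((2 - α) ^ 2 * t) :=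
    fun x t ht => by positivity
  have up : ∀ (x : E N) (t : ℝ), 0 < t → |PhiK N α β x t| ≤ C * Psi α (-β) x t := by
    intro x t ht
    rw [aux_Psi α (-β) hα1 x t ht, PhiK, phiK, abs_mul, abs_of_pos (Real.rpow_pos_of_pos ht _)]
    have := mul_le_mul_of_nonneg_left (hU _ (hs x t ht)).2 (Real.rpow_pos_of_pos ht (-β)).le
    linarith
  refine ⟨C, hC, up, fun hβ => ?_⟩
  obtain ⟨c, hc0, hL⟩ := aux_kum_low (((N : ℝ) - α) / (2 - α) - β) (((N : ℝ) - α) / (2 - α)) hc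
    (by linarith)
  simp only [sub_sub_cancel_left] at hL
  have low : ∀ (x : E N) (t : ℝ), 0 < t → c * Psi α (-β) x t ≤ PhiK N α β x t := by
    intro x t ht
    rw [aux_Psi α (-β) hα1 x t ht, PhiK, phiK]
    have := mul_le_mul_of_nonneg_left (hL _ (hs x t ht)) (Real.rpow_pos_of_pos ht (-β)).le
    linarith
  refine ⟨c, hc0, low, fun x t ht => ?_⟩
  have hb : 0 < t + ‖x‖ ^ (2 - α) / (2 - α) ^ 2 := by positivity
  have hP : 0 < Psi α (-β) x t := Real.rpow_pos_of_pos hb _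
  have e : Psi α β x t = (Psi α (-β) x t)⁻¹ := by
    rw [Psi, Psi, Real.rpow_neg hb.le, inv_inv]
  have l := low x t ht
  have hpos : 0 < PhiK N α β x t := lt_of_lt_of_le (by positivity) l
  rw [e, ← mul_inv, ← mul_inv]
  exact ⟨inv_anti₀ hpos ((le_abs_self _).trans (up x t ht)), inv_anti₀ (by positivity) l⟩
end
end
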